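/- arXiv:2403.18773 — 2 statements merged into one kernel-verified Lean document; each statement's English description precedes it below -/
import Mathlib

section
/- Let A be a C*-algebra, M a Banach A-bimodule, and F : A → M a linear map such that there exist maps G, H : A → M with F(ab) = G(a)b + aH(b) for all a,b ∈ A. Then F is continuous. -/
open Filter Topology
open scoped ComplexStarModule

/-- A star projection with no proper nonzero subprojections (the zero projection is allowed). -/
def IsMinimalStarProjection {Q : Type*} [Ring Q] [StarRing Q] (p : Q) : Prop :=
  IsStarProjection p ∧ ∀ e, IsStarProjection e → p * e = e → e = 0 ∨ e = p

/-- `x` is a finite linear combination of mutually orthogonal star projections. -/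
def HasFiniteSpectralDecomposition {Q : Type*} [Ring Q] [Algebra ℂ Q] [StarRing Q] (x : Q) : Prop :=
  ∃ (ι : Type) (_ : Fintype ι) (c : ι → ℂ) (e : ι → Q),
    (∀ i, IsStarProjection (e i)) ∧ (∀ i j, i ≠ j → e i * e j = 0) ∧ x = ∑ i, c i • e i

section StarRing

variable {Q : Type*} [Ring Q] [StarRing Q]

theorem IsStarProjection.mul_eq_of_mul_eq {p e : Q} (hp : IsStarProjection p)
    (he : IsStarProjection e) (h : p * e = e) : e * p = e := by
  have := congrArg star h
  rwa [star_mul, hp.isSelfAdjoint.star_eq, he.isSelfAdjoint.star_eq] at this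

theorem IsStarProjection.sub_of_mul_eq {p e : Q} (hp : IsStarProjection p)
    (he : IsStarProjection e) (h : p * e = e) : IsStarProjection (p - e) := by
  refine ⟨?_, hp.isSelfAdjoint.sub he.isSelfAdjoint⟩
  have h1 := hp.isIdempotentElem.eq
  have h2 := he.isIdempotentElem.eq
  have h3 := hp.mul_eq_of_mul_eq he h
  simp only [IsIdempotentElem, mul_sub, sub_mul, h, h1, h2, h3]
  abel

theorem IsStarProjection.mem_closure_isMinimalStarProjection
    (horth : ∀ e : ℕ → Q, (∀ n, IsStarProjection (e n)) → (∀ m n, m ≠ n → e m * e n = 0) →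
      ∃ n, e n = 0)
    {p : Q} (hp : IsStarProjection p) :
    p ∈ AddSubmonoid.closure {p : Q | IsMinimalStarProjection p} := by
  set S := AddSubmonoid.closure {p : Q | IsMinimalStarProjection p} with hS
  by_contra hpS
  have step (q : {q : Q // IsStarProjection q ∧ q ∉ S}) :
      ∃ r : {q : Q // IsStarProjection q ∧ q ∉ S}, q.1 * r.1 = r.1 ∧ q.1 - r.1 ≠ 0 := by
    obtain ⟨q, hq, hqS⟩ := q
    have hmin : ¬ IsMinimalStarProjection q := fun h => hqS (AddSubmonoid.subset_closure h)
    simp only [IsMinimalStarProjection, hq, true_and, not_forall, not_or] at hmin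
    obtain ⟨e, he, hqe, he0, heq⟩ := hmin
    by_cases heS : e ∈ S
    · refine ⟨⟨q - e, hq.sub_of_mul_eq he hqe, fun h => hqS ?_⟩, ?_, ?_⟩
      · simpa using S.add_mem heS h
      · simp [mul_sub, hqe, hq.isIdempotentElem.eq]
      · simpa using he0
    · exact ⟨⟨e, he, heS⟩, hqe, sub_ne_zero.2 (Ne.symm heq)⟩
  choose f hf hf0 using step
  let P : ℕ → {q : Q // IsStarProjection q ∧ q ∉ S} := fun n => f^[n] ⟨p, hp, hpS⟩
  have hP (n : ℕ) : P (n + 1) = f (P n) := Function.iterate_succ_apply' f n _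
  have hle (m n : ℕ) (h : m ≤ n) : (P m).1 * (P n).1 = (P n).1 := by
    induction n, h using Nat.le_induction with
    | base => exact (P m).2.1.isIdempotentElem.eq
    | succ n _ ih => rw [hP, ← hf (P n), ← mul_assoc, ih]
  have hd (n : ℕ) : IsStarProjection ((P n).1 - (P (n + 1)).1) :=
    (P n).2.1.sub_of_mul_eq (P (n + 1)).2.1 (hle _ _ n.le_succ)
  have hlt (m n : ℕ) (h : m < n) :
      ((P m).1 - (P (m + 1)).1) * ((P n).1 - (P (n + 1)).1) = 0 := by
    rw [sub_mul, mul_sub, mul_sub, hle m n h.le, hle m (n + 1) (by omega),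
      hle (m + 1) n h, hle (m + 1) (n + 1) (by omega), sub_self]
  obtain ⟨n, hn⟩ := horth _ hd fun m n hmn => by
    rcases lt_or_gt_of_ne hmn with h | h
    · exact hlt m n h
    · have := congrArg star (hlt n m h)
      rwa [star_mul, (hd n).isSelfAdjoint.star_eq, (hd m).isSelfAdjoint.star_eq, star_zero] at this
  exact hf0 (P n) (by rw [← hP]; exact hn)

end StarRing

section StarAlgebra

variable {Q : Type*} [Ring Q] [Algebra ℂ Q] [StarRing Q]

theorem IsMinimalStarProjection.corner_of_isSelfAdjoint {p : Q} (hp : IsMinimalStarProjection p)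
    {x : Q} (hx : HasFiniteSpectralDecomposition x) (hpx : p * x = x) (hxp : x * p = x) :
    ∃ c : ℂ, x = c • p := by
  obtain ⟨ι, _, c, e, he, horth, rfl⟩ := hx
  set x := ∑ i, c i • e i with hxdef
  have hxe (i : ι) : x * e i = c i • e i := by
    rw [hxdef, Finset.sum_mul, Finset.sum_eq_single i]
    · rw [smul_mul_assoc, (he i).isIdempotentElem.eq]
    · intro j _ hj
      rw [smul_mul_assoc, horth j i hj, smul_zero]
    · simp
  by_cases h : ∃ i, c i • e i ≠ 0
  · obtain ⟨i, hi⟩ := h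
    have hci : c i ≠ 0 := fun h => hi (by simp [h])
    have hpe : p * e i = e i := by
      have : c i • (p * e i) = c i • e i := by
        rw [← mul_smul_comm, ← hxe, ← mul_assoc, hpx]
      exact (smul_right_injective Q hci) this
    rcases hp.2 _ (he i) hpe with h0 | h1
    · exact absurd (by simp [h0]) hi
    · refine ⟨c i, ?_⟩
      rw [← hxp, ← h1, hxe]
  · push Not at h
    exact ⟨0, by simp [hxdef, h]⟩

variable [StarModule ℂ Q]

theorem IsMinimalStarProjection.corner
    (hspec : ∀ x : Q, IsSelfAdjoint x → HasFiniteSpectralDecomposition x)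
    {p : Q} (hp : IsMinimalStarProjection p) (x : Q) : ∃ c : ℂ, p * x * p = c • p := by
  have key (y : Q) (hy : IsSelfAdjoint y) : ∃ c : ℂ, p * y * p = c • p := by
    have hpp := hp.1.isIdempotentElem.eq
    refine hp.corner_of_isSelfAdjoint (hspec _ ?_) ?_ ?_
    · have := hy.conjugate p
      rwa [hp.1.isSelfAdjoint.star_eq] at this
    · rw [← mul_assoc, ← mul_assoc, hpp]
    · rw [mul_assoc, hpp]
  obtain ⟨c, hc⟩ := key (ℜ x) (ℜ x).2
  obtain ⟨d, hd⟩ := key (ℑ x) (ℑ x).2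
  refine ⟨c + Complex.I * d, ?_⟩
  conv_lhs => rw [← realPart_add_I_smul_imaginaryPart x]
  rw [mul_add, add_mul, hc, mul_smul_comm, smul_mul_assoc, hd, smul_smul, add_smul]

theorem IsMinimalStarProjection.off_corner
    (hproper : ∀ x : Q, star x * x = 0 → x = 0)
    (hspec : ∀ x : Q, IsSelfAdjoint x → HasFiniteSpectralDecomposition x)
    {p q : Q} (hp : IsMinimalStarProjection p) (hq : IsMinimalStarProjection q) :
    ∃ z : Q, ∀ y, ∃ c : ℂ, p * y * q = c • z := by
  by_cases h : ∃ x, p * x * q ≠ 0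
  · obtain ⟨x, hx⟩ := h
    have hpp := hp.1.isIdempotentElem.eq
    have hqq := hq.1.isIdempotentElem.eq
    have hstar : star (p * x * q) = q * star x * p := by
      rw [star_mul, star_mul, hp.1.isSelfAdjoint.star_eq, hq.1.isSelfAdjoint.star_eq, mul_assoc]
    obtain ⟨c, hc⟩ := hq.corner hspec (star x * p * p * x)
    have hz : star (p * x * q) * (p * x * q) = c • q := by
      rw [← hc, hstar]; simp only [mul_assoc]
    have hc0 : c ≠ 0 := by
      rintro rfl
      exact hx (hproper _ (by rw [hz, zero_smul]))
    refine ⟨p * x * q, fun y => ?_⟩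
    obtain ⟨d, hd⟩ := hp.corner hspec (y * q * q * star x)
    refine ⟨c⁻¹ * d, ?_⟩
    have h1 : c • (p * y * q) = d • (p * x * q) := by
      calc c • (p * y * q) = p * y * q * (c • q) := by
            rw [mul_smul_comm, mul_assoc _ q q, hqq]
        _ = p * (y * q * q * star x) * p * (p * x * q) := by
            rw [← hz, hstar]; simp only [mul_assoc]
        _ = d • (p * x * q) := by
            rw [hd, smul_mul_assoc, ← mul_assoc, ← mul_assoc, hpp]
    rw [mul_smul, ← h1, smul_smul, inv_mul_cancel₀ hc0, one_smul]
  · push Not at h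
    exact ⟨0, fun y => ⟨0, by simp [h y]⟩⟩

/-- A proper complex star algebra whose self-adjoint elements have finite spectral decompositions
and which has no infinite orthogonal sequence of nonzero projections is finite-dimensional. -/
theorem finiteDimensional_of_finiteSpectralDecomposition
    (hproper : ∀ x : Q, star x * x = 0 → x = 0)
    (hspec : ∀ x : Q, IsSelfAdjoint x → HasFiniteSpectralDecomposition x)
    (horth : ∀ e : ℕ → Q, (∀ n, IsStarProjection (e n)) → (∀ m n, m ≠ n → e m * e n = 0) →
      ∃ n, e n = 0) :
    FiniteDimensional ℂ Q := by
  have h1 := (IsStarProjection.one (R := Q)).mem_closure_isMinimalStarProjection horth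
  have key : ∃ W : Submodule ℂ Q, FiniteDimensional ℂ W ∧ ∀ x : Q, 1 * x * 1 ∈ W := by
    refine AddSubmonoid.closure_induction₂
      (motive := fun p q _ _ => ∃ W : Submodule ℂ Q, FiniteDimensional ℂ W ∧ ∀ x : Q, p * x * q ∈ W)
      ?_ ?_ ?_ ?_ ?_ h1 h1
    · intro p q hp hq
      obtain ⟨z, hz⟩ := hp.off_corner hproper hspec hq
      refine ⟨ℂ ∙ z, inferInstance, fun x => ?_⟩
      obtain ⟨c, hc⟩ := hz x
      exact Submodule.mem_span_singleton.2 ⟨c, hc.symm⟩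
    · exact fun x _ => ⟨⊥, inferInstance, by simp⟩
    · exact fun x _ => ⟨⊥, inferInstance, by simp⟩
    · rintro p q r _ _ _ ⟨W, _, hW⟩ ⟨V, _, hV⟩
      refine ⟨W ⊔ V, inferInstance, fun x => ?_⟩
      rw [add_mul, add_mul]
      exact Submodule.add_mem_sup (hW x) (hV x)
    · rintro p q r _ _ _ ⟨W, _, hW⟩ ⟨V, _, hV⟩
      refine ⟨W ⊔ V, inferInstance, fun x => ?_⟩
      rw [mul_add]
      exact Submodule.add_mem_sup (hW x) (hV x)
  obtain ⟨W, hW, hmem⟩ := key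
  have : W = ⊤ := Submodule.eq_top_iff'.2 fun x => by simpa using hmem x
  subst this
  exact Module.Finite.equiv (Submodule.topEquiv (R := ℂ) (M := Q))

end StarAlgebra

/-- A continuous truncation of the inverse. -/
noncomputable def truncInv (ε t : ℝ) : ℝ := (max t ε)⁻¹

theorem continuous_truncInv {ε : ℝ} (hε : 0 < ε) : Continuous (truncInv ε) :=
  (continuous_id.max continuous_const).inv₀ fun _ => (lt_max_of_lt_right hε).ne'

theorem truncInv_mul_self_mem_Icc {ε t : ℝ} (hε : 0 < ε) (ht : 0 ≤ t) :
    truncInv ε t * t ∈ Set.Icc 0 1 := by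
  have hm : 0 < max t ε := lt_max_of_lt_right hε
  unfold truncInv
  refine ⟨by positivity, ?_⟩
  rw [inv_mul_le_one₀ hm]
  exact le_max_left _ _

theorem abs_sub_truncInv_mul_sq_le {ε t : ℝ} (hε : 0 < ε) (ht : 0 ≤ t) :
    |t - truncInv ε t * t ^ 2| ≤ ε := by
  obtain ⟨h0, h1⟩ := truncInv_mul_self_mem_Icc hε ht
  rcases le_total t ε with h | h
  · rw [abs_le]
    constructor <;> nlinarith
  · rcases ht.eq_or_lt with rfl | ht
    · simpa using hε.le
    · have : truncInv ε t * t ^ 2 = t := by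
        rw [truncInv, max_eq_left h]; field_simp
      simpa [this] using hε.le

section CStarAlgebra

variable {A : Type*} [CStarAlgebra A] [PartialOrder A] [StarOrderedRing A]

theorem norm_cfc_mul_le_of_mul_star_le {u x : A} (hu : 0 ≤ u) (h : x * star x ≤ u ^ 4)
    {f : ℝ → ℝ} (hf : Continuous f) {δ : ℝ} (hδ : 0 ≤ δ)
    (hfδ : ∀ t ∈ spectrum ℝ u, |f t * t ^ 2| ≤ δ) : ‖cfc f u * x‖ ≤ δ := by
  have hsa : IsSelfAdjoint u := hu.isSelfAdjoint
  have hF : IsSelfAdjoint (cfc f u) := cfc_predicate f u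
  have h2 : cfc f u * u ^ 2 = cfc (fun t => f t * t ^ 2) u := by
    rw [cfc_mul f (fun t => t ^ 2) u hf.continuousOn (by fun_prop), cfc_pow_id (R := ℝ) u 2]
  have h3 : u ^ 2 * cfc f u = cfc (fun t => f t * t ^ 2) u := by
    rw [← h2, ← cfc_pow_id (R := ℝ) u 2]
    exact cfc_commute_cfc _ _ u
  have hle : cfc f u * (x * star x) * cfc f u ≤ cfc f u * u ^ 4 * cfc f u := by
    simpa [hF.star_eq] using star_left_conjugate_le_conjugate h (cfc f u)
  have hnn : 0 ≤ cfc f u * (x * star x) * cfc f u := by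
    simpa [hF.star_eq] using star_left_conjugate_nonneg (mul_star_self_nonneg x) (cfc f u)
  have hn : ‖cfc f u * x‖ * ‖cfc f u * x‖ ≤ δ * δ := by
    calc ‖cfc f u * x‖ * ‖cfc f u * x‖ = ‖cfc f u * (x * star x) * cfc f u‖ := by
          rw [← CStarRing.norm_self_mul_star, star_mul, hF.star_eq]; simp only [mul_assoc]
      _ ≤ ‖cfc f u * u ^ 4 * cfc f u‖ := CStarAlgebra.norm_le_norm_of_nonneg_of_le hnn hle
      _ = ‖cfc (fun t => f t * t ^ 2) u * cfc (fun t => f t * t ^ 2) u‖ := by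
          rw [show u ^ 4 = u ^ 2 * u ^ 2 by rw [← pow_add], ← mul_assoc, h2, mul_assoc, h3]
      _ ≤ ‖cfc (fun t => f t * t ^ 2) u‖ * ‖cfc (fun t => f t * t ^ 2) u‖ := norm_mul_le _ _
      _ ≤ δ * δ := by
          have := norm_cfc_le (a := u) (f := fun t => f t * t ^ 2) hδ hfδ
          gcongr
  exact abs_le_of_sq_le_sq' (by nlinarith) hδ |>.2

theorem exists_eq_mul_of_mul_star_le_pow_four {u x : A} (hu : 0 ≤ u) (h : x * star x ≤ u ^ 4) :
    ∃ c, x = u * c ∧ ‖c‖ ≤ ‖u‖ := by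
  rcases subsingleton_or_nontrivial A with _ | _
  · exact ⟨u, Subsingleton.elim _ _, le_rfl⟩
  have hsa : IsSelfAdjoint u := hu.isSelfAdjoint
  have hpos (t : ℝ) (ht : t ∈ spectrum ℝ u) : 0 ≤ t := spectrum_nonneg_of_nonneg hu ht
  let ε : ℕ → ℝ := fun k => 1 / ((k : ℝ) + 1)
  have hε (k : ℕ) : 0 < ε k := Nat.one_div_pos_of_nat
  have hεlim : Tendsto ε atTop (𝓝 0) := tendsto_one_div_add_atTop_nhds_zero_nat
  have hεanti {m n : ℕ} (hmn : m ≤ n) : ε n ≤ ε m := Nat.one_div_le_one_div hmn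
  have hcont (k : ℕ) := continuous_truncInv (hε k)
  let c : ℕ → A := fun k => cfc (truncInv (ε k)) u * x
  have hcauchy : CauchySeq c := by
    refine cauchySeq_of_le_tendsto_0 (fun N => 2 * ε N) (fun m n N hm hn => ?_)
      (by simpa using hεlim.const_mul 2)
    rw [dist_eq_norm, ← sub_mul,
      ← cfc_sub _ _ u (hcont m).continuousOn (hcont n).continuousOn]
    refine norm_cfc_mul_le_of_mul_star_le hu h ((hcont m).sub (hcont n))
      (by linarith [hε N]) fun t ht => ?_
    have h1 := abs_le.1 (abs_sub_truncInv_mul_sq_le (hε m) (hpos t ht))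
    have h2 := abs_le.1 (abs_sub_truncInv_mul_sq_le (hε n) (hpos t ht))
    have := hεanti hm
    have := hεanti hn
    rw [Pi.sub_apply, sub_mul, abs_le]
    constructor <;> linarith
  obtain ⟨d, hd⟩ := cauchySeq_tendsto_of_complete hcauchy
  refine ⟨d, ?_, ?_⟩
  · refine tendsto_nhds_unique (f := fun k => u * c k) (l := atTop) ?_ (hd.const_mul u)
    rw [tendsto_iff_norm_sub_tendsto_zero]
    refine squeeze_zero (fun _ => norm_nonneg _) (fun k => ?_)
      (by simpa using hεlim.mul_const ‖u‖)
    have heq : u * c k - x = cfc (fun t => t * truncInv (ε k) t - 1) u * x := by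
      rw [cfc_sub (fun t => t * truncInv (ε k) t) (fun _ => 1) u
          (continuous_id.mul (hcont k)).continuousOn continuousOn_const,
        cfc_mul (fun t => t) _ u continuousOn_id (hcont k).continuousOn, cfc_id' ℝ u, cfc_const_one ℝ u,
        sub_mul, one_mul, mul_assoc]
    rw [heq]
    refine norm_cfc_mul_le_of_mul_star_le hu h (by have := hcont k; fun_prop)
      (mul_nonneg (hε k).le (norm_nonneg _)) fun t ht => ?_
    have h0 := hpos t ht
    have htu : t ≤ ‖u‖ := (Real.norm_of_nonneg h0).symm.trans_le (spectrum.norm_le_norm_of_mem ht)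
    calc |(t * truncInv (ε k) t - 1) * t ^ 2| = |t - truncInv (ε k) t * t ^ 2| * |t| := by
          rw [← abs_mul, ← abs_neg]; congr 1; ring
      _ ≤ ε k * ‖u‖ := by
          rw [abs_of_nonneg h0]
          exact mul_le_mul (abs_sub_truncInv_mul_sq_le (hε k) h0) htu h0 (hε k).le
  · refine le_of_tendsto hd.norm (Eventually.of_forall fun k => ?_)
    refine norm_cfc_mul_le_of_mul_star_le hu h (hcont k) (norm_nonneg _) fun t ht => ?_
    have h0 := hpos t ht
    have htu : t ≤ ‖u‖ := (Real.norm_of_nonneg h0).symm.trans_le (spectrum.norm_le_norm_of_mem ht)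
    obtain ⟨h2, h3⟩ := truncInv_mul_self_mem_Icc (hε k) h0
    rw [show truncInv (ε k) t * t ^ 2 = truncInv (ε k) t * t * t by ring,
      abs_of_nonneg (mul_nonneg h2 h0)]
    nlinarith

theorem Ideal.mem_of_mul_self_mem_of_nonneg {J : Ideal A} (hJ : IsClosed (J : Set A)) {u : A}
    (hu : 0 ≤ u) (h : u * u ∈ J) : u ∈ J := by
  have hsa : IsSelfAdjoint u := hu.isSelfAdjoint
  let ε : ℕ → ℝ := fun k => 1 / ((k : ℝ) + 1)
  have hε (k : ℕ) : 0 < ε k := Nat.one_div_pos_of_nat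
  have hεlim : Tendsto ε atTop (𝓝 0) := tendsto_one_div_add_atTop_nhds_zero_nat
  have hcont (k : ℕ) := continuous_truncInv (hε k)
  have hlim : Tendsto (fun k => cfc (truncInv (ε k)) u * (u * u)) atTop (𝓝 u) := by
    rw [tendsto_iff_norm_sub_tendsto_zero]
    refine squeeze_zero (fun _ => norm_nonneg _) (fun k => ?_) hεlim
    have heq : u - cfc (truncInv (ε k)) u * (u * u)
        = cfc (fun t => t - truncInv (ε k) t * t ^ 2) u := by
      rw [cfc_sub (fun t => t) (fun t => truncInv (ε k) t * t ^ 2) u continuousOn_id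
          ((hcont k).mul (continuous_pow 2)).continuousOn,
        cfc_mul _ (fun t => t ^ 2) u (hcont k).continuousOn (by fun_prop), cfc_id' ℝ u, cfc_pow_id (R := ℝ) u 2,
        sq]
    rw [norm_sub_rev, heq]
    exact norm_cfc_le (hε k).le fun t ht =>
      abs_sub_truncInv_mul_sq_le (hε k) (spectrum_nonneg_of_nonneg hu ht)
  exact hJ.mem_of_tendsto hlim (Eventually.of_forall fun k => J.mul_mem_left _ h)

theorem exists_nonneg_pow_four_eq {J : Ideal A} (hJ : IsClosed (J : Set A)) {s : A}
    (hs : 0 ≤ s) (h : s ∈ J) : ∃ u, 0 ≤ u ∧ u ^ 4 = s ∧ u ∈ J := by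
  have h1 := CFC.sqrt_mul_sqrt_self s hs
  have h0 := CFC.sqrt_nonneg s
  have h2 := CFC.sqrt_mul_sqrt_self (CFC.sqrt s) h0
  refine ⟨CFC.sqrt (CFC.sqrt s), CFC.sqrt_nonneg _, ?_, ?_⟩
  · rw [show 4 = 2 * 2 by rfl, pow_mul, sq (CFC.sqrt (CFC.sqrt s)), h2, sq, h1]
  · refine J.mem_of_mul_self_mem_of_nonneg hJ (CFC.sqrt_nonneg _) ?_
    rw [h2]
    refine J.mem_of_mul_self_mem_of_nonneg hJ h0 ?_
    rwa [h1]

theorem Ideal.mem_of_mul_star_mem {J : Ideal A} [J.IsTwoSided] (hJ : IsClosed (J : Set A)) {x : A}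
    (h : x * star x ∈ J) : x ∈ J := by
  obtain ⟨u, hu, hus, huJ⟩ := exists_nonneg_pow_four_eq hJ (mul_star_self_nonneg x) h
  obtain ⟨c, rfl, -⟩ := exists_eq_mul_of_mul_star_le_pow_four hu hus.ge
  exact J.mul_mem_right _ huJ

end CStarAlgebra

section Quotient

/-- The star ring structure on the quotient by a star-closed two-sided ideal. -/
@[reducible]
def Ideal.Quotient.starRing {A : Type*} [Ring A] [StarRing A] (J : Ideal A) [J.IsTwoSided]
    (hstar : ∀ a ∈ J, star a ∈ J) : StarRing (A ⧸ J) :=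
  let φ : A ⧸ J →+* (A ⧸ J)ᵐᵒᵖ :=
    Ideal.Quotient.lift J ((Ideal.Quotient.mk J).op.comp (starRingEquiv (R := A)).toRingHom)
      fun a ha => MulOpposite.unop_injective (Ideal.Quotient.eq_zero_iff_mem.2 (hstar a ha))
  { star := fun x => (φ x).unop
    star_involutive := fun x => by
      obtain ⟨a, rfl⟩ := Ideal.Quotient.mk_surjective x
      exact congrArg (Ideal.Quotient.mk J) (star_star a)
    star_mul := fun x y => by
      change (φ (x * y)).unop = _
      rw [map_mul]; rfl
    star_add := fun x y => by
      change (φ (x + y)).unop = _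
      rw [map_add]; rfl }

variable {A : Type*} [CStarAlgebra A]

/-- The continuous functional calculus reduces a self-adjoint element to a finite combination of
orthogonal projections modulo `J`, as long as `J` admits no infinite orthogonal sequences. -/
theorem exists_finite_spectral_decomposition_mod (J : Ideal A) [J.IsTwoSided]
    (hJ : IsClosed (J : Set A))
    (horth : ∀ c : ℕ → A, (∀ n, IsSelfAdjoint (c n)) → (∀ m n, m ≠ n → c m * c n ∈ J) →
      ∃ n, c n * c n ∈ J)
    {a : A} (ha : IsSelfAdjoint a) :
    ∃ (ι : Type) (_ : Fintype ι) (c : ι → ℂ) (e : ι → A), (∀ i, IsSelfAdjoint (e i)) ∧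
      (∀ i, e i * e i - e i ∈ J) ∧ (∀ i j, i ≠ j → e i * e j ∈ J) ∧
      a - ∑ i, c i • e i ∈ J := by
  have hn : IsStarNormal a := ha.isStarNormal
  let φ : C(spectrum ℂ a, ℂ) →⋆ₐ[ℂ] A := cfcHom hn
  let I : Ideal C(spectrum ℂ a, ℂ) := J.comap φ
  have hI : IsClosed (I : Set C(spectrum ℂ a, ℂ)) := hJ.preimage (cfcHom_continuous hn)
  let K : Set (spectrum ℂ a) := (ContinuousMap.setOfIdeal I)ᶜ
  have hmem (f : C(spectrum ℂ a, ℂ)) : φ f ∈ J ↔ ∀ x ∈ K, f x = 0 := by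
    change f ∈ I ↔ _
    rw [← ContinuousMap.idealOfSet_ofIdeal_isClosed hI, ContinuousMap.mem_idealOfSet]
  have hsa (f : C(spectrum ℂ a, ℝ)) :
      IsSelfAdjoint (φ ((⟨Complex.ofReal, Complex.continuous_ofReal⟩ : C(ℝ, ℂ)).comp f)) := by
    refine IsSelfAdjoint.map ?_ φ
    ext x
    simp
  have hK : K.Finite := by
    by_contra hinf
    have : Infinite K := Set.infinite_coe_iff.2 hinf
    obtain ⟨U, hUinf, hUo, hUd⟩ := exists_seq_infinite_isOpen_pairwise_disjoint K
    choose V hVo hVU using fun n => isOpen_induced_iff.1 (hUo n)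
    have hne (n : ℕ) : (U n).Nonempty := (hUinf n).nonempty
    have hdisj (m n : ℕ) (hmn : m ≠ n) (x : spectrum ℂ a) (hx : x ∈ K) (hm : x ∈ V m)
        (hxn : x ∈ V n) : False := by
      have hm' : (⟨x, hx⟩ : K) ∈ U m := by rw [← hVU]; exact hm
      have hn' : (⟨x, hx⟩ : K) ∈ U n := by rw [← hVU]; exact hxn
      exact Set.disjoint_left.1 (hUd hmn) hm' hn'
    have hVc (n : ℕ) : ((V n)ᶜ).Nonempty := by
      obtain ⟨x, hx⟩ := hne (n + 1)
      rw [← hVU] at hx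
      exact ⟨x, fun h => hdisj n (n + 1) (by omega) x x.2 h hx⟩
    let f (n : ℕ) : C(spectrum ℂ a, ℝ) :=
      ⟨fun x => Metric.infDist x (V n)ᶜ, Metric.continuous_infDist_pt _⟩
    have hf0 (n : ℕ) (x : spectrum ℂ a) : f n x = 0 ↔ x ∉ V n :=
      ((hVo n).isClosed_compl.mem_iff_infDist_zero (hVc n)).symm
    obtain ⟨n, hnJ⟩ := horth _ (fun n => hsa (f n)) fun m n hmn => by
      rw [← map_mul, hmem]
      intro x hx
      by_cases hxm : x ∈ V m
      · have : f n x = 0 := (hf0 n x).2 fun h => hdisj m n hmn x hx hxm h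
        simp [this]
      · simp [(hf0 m x).2 hxm]
    rw [← map_mul, hmem] at hnJ
    obtain ⟨x, hx⟩ := hne n
    rw [← hVU] at hx
    have := hnJ x x.2
    simp [hf0] at this
    exact this hx
  have : Fintype K := hK.fintype
  classical
  let g (i : K) : C(spectrum ℂ a, ℝ) :=
    ⟨fun x => ∏ j ∈ Finset.univ.erase i, dist x j.1 / dist i.1 j.1, by fun_prop⟩
  have hgi (i : K) : g i i = 1 := by
    refine Finset.prod_eq_one fun j hj => div_self ?_
    exact dist_ne_zero.2 fun h => Finset.ne_of_mem_erase hj (Subtype.ext h.symm)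
  have hgj (i j : K) (hij : i ≠ j) : g i j = 0 :=
    Finset.prod_eq_zero (Finset.mem_erase.2 ⟨hij.symm, Finset.mem_univ j⟩) (by simp)
  refine ⟨K, inferInstance, fun i => i.1.1, _, fun i => hsa (g i), fun i => ?_, fun i j hij => ?_,
    ?_⟩
  · rw [← map_mul, ← map_sub, hmem]
    intro x hx
    by_cases h : i = ⟨x, hx⟩
    · have : g i x = 1 := by rw [h]; exact hgi ⟨x, hx⟩
      simp [this]
    · have : g i x = 0 := hgj i ⟨x, hx⟩ h
      simp [this]
  · rw [← map_mul, hmem]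
    intro x hx
    by_cases h : i = ⟨x, hx⟩
    · have : g j x = 0 := hgj j ⟨x, hx⟩ fun h' => hij (h.trans h'.symm)
      simp [this]
    · have : g i x = 0 := hgj i ⟨x, hx⟩ h
      simp [this]
  · have hid : φ ((ContinuousMap.id ℂ).restrict (spectrum ℂ a)) = a := cfcHom_id hn
    nth_rewrite 1 [← hid]
    simp only [← map_smul, ← map_sum, ← map_sub]
    rw [hmem]
    intro x hx
    have hs : ∑ i : K, (i.1.1 : ℂ) * (g i x : ℂ) = x := by
      rw [Finset.sum_eq_single (⟨x, hx⟩ : K)]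
      · have : g ⟨x, hx⟩ x = 1 := hgi ⟨x, hx⟩
        simp [this]
      · intro i _ hi
        have : g i x = 0 := hgj i ⟨x, hx⟩ hi
        simp [this]
      · simp
    simp [ContinuousMap.sum_apply, hs]

theorem finiteDimensional_quotient_of_orthogonal (J : Ideal A) [J.IsTwoSided]
    (hJ : IsClosed (J : Set A)) (hstar : ∀ a ∈ J, star a ∈ J)
    (horth : ∀ c : ℕ → A, (∀ n, IsSelfAdjoint (c n)) → (∀ m n, m ≠ n → c m * c n ∈ J) →
      ∃ n, c n * c n ∈ J) :
    FiniteDimensional ℂ (A ⧸ J) := by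
  let _ := Ideal.Quotient.starRing J hstar
  let _ := CStarAlgebra.spectralOrder A
  have := CStarAlgebra.spectralOrderedRing A
  let π := Ideal.Quotient.mk J
  have hπstar (a : A) : star (π a) = π (star a) := rfl
  have hπsmul (c : ℂ) (a : A) : π (c • a) = c • π a := rfl
  have hπ0 (a : A) : π a = 0 ↔ a ∈ J := Ideal.Quotient.eq_zero_iff_mem
  have : StarModule ℂ (A ⧸ J) := ⟨fun c x => by
    obtain ⟨a, rfl⟩ := Ideal.Quotient.mk_surjective x
    change star (π (c • a)) = star c • star (π a)
    rw [hπstar, star_smul, hπstar, hπsmul]⟩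
  have hlift (x : A ⧸ J) (hx : IsSelfAdjoint x) : ∃ a, IsSelfAdjoint a ∧ π a = x := by
    obtain ⟨a, rfl⟩ := Ideal.Quotient.mk_surjective x
    refine ⟨(2⁻¹ : ℂ) • (a + star a), ?_, ?_⟩
    · rw [IsSelfAdjoint, star_smul, star_add, star_star, add_comm]
      simp
    · have : star (π a) = π a := hx
      rw [hπsmul, map_add, ← hπstar, this, ← two_smul ℂ, smul_smul, inv_mul_cancel₀ two_ne_zero,
        one_smul]
  refine finiteDimensional_of_finiteSpectralDecomposition ?_ ?_ ?_
  · intro x hx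
    obtain ⟨a, rfl⟩ := Ideal.Quotient.mk_surjective x
    change star (π a) * π a = 0 at hx
    rw [hπstar, ← map_mul, hπ0] at hx
    refine (hπ0 a).2 ?_
    rw [← star_star a]
    exact hstar _ (J.mem_of_mul_star_mem hJ (by rwa [star_star]))
  · intro x hx
    obtain ⟨a, ha, rfl⟩ := hlift x hx
    obtain ⟨ι, hι, c, e, hsa, hid, hort, hsum⟩ :=
      exists_finite_spectral_decomposition_mod J hJ horth ha
    refine ⟨ι, hι, c, fun i => π (e i), fun i => ⟨?_, ?_⟩, fun i j hij => ?_, ?_⟩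
    · rw [IsIdempotentElem, ← map_mul, ← sub_eq_zero, ← map_sub, hπ0]
      exact hid i
    · rw [IsSelfAdjoint, hπstar, (hsa i).star_eq]
    · rw [← map_mul, hπ0]
      exact hort i j hij
    · simp only [← hπsmul]
      rw [← map_sum, ← sub_eq_zero, ← map_sub, hπ0]
      exact hsum
  · intro e he hort
    choose c hc hce using fun n => hlift (e n) (he n).isSelfAdjoint
    obtain ⟨n, hn⟩ := horth c hc fun m n hmn => by
      rw [← hπ0, map_mul, hce, hce, hort m n hmn]
    refine ⟨n, ?_⟩
    rw [← (he n).isIdempotentElem.eq, ← hce, ← map_mul, hπ0]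
    exact hn

end Quotient

section NormedSpace

theorem exists_large_of_not_continuous {E F : Type*} [NormedAddCommGroup E] [NormedSpace ℂ E]
    [NormedAddCommGroup F] [NormedSpace ℂ F] (f : E →ₗ[ℂ] F) (hf : ¬ Continuous f) {δ : ℝ}
    (hδ : 0 < δ) (R : ℝ) : ∃ t, ‖t‖ ≤ δ ∧ R ≤ ‖f t‖ := by
  by_contra! h
  obtain ⟨C, hC⟩ := f.bound_of_ball_bound hδ R fun z hz => (h z (mem_ball_zero_iff.1 hz).le).le
  exact hf (f.mkContinuous C hC).continuous

theorem continuous_of_bound_on_finite_codim {E F : Type*} [NormedAddCommGroup E]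
    [NormedSpace ℂ E] [CompleteSpace E] [NormedAddCommGroup F] [NormedSpace ℂ F] (f : E →ₗ[ℂ] F)
    (p : Submodule ℂ E) (hp : IsClosed (p : Set E)) [FiniteDimensional ℂ (E ⧸ p)] {C : ℝ}
    (hC : ∀ x ∈ p, ‖f x‖ ≤ C * ‖x‖) : Continuous f := by
  obtain ⟨P, hP⟩ := Submodule.ClosedComplemented.of_finiteDimensional_quotient hp
  let g : p →L[ℂ] F := (f.comp p.subtype).mkContinuous C fun x => hC x x.2
  let k : E →ₗ[ℂ] F := f - f.comp (p.subtype.comp P.toLinearMap)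
  have hk : p ≤ LinearMap.ker k := fun x hx => by
    have : P x = ⟨x, hx⟩ := hP ⟨x, hx⟩
    simp [k, this]
  have hkc : Continuous k := by
    have heq : (k : E → F) = p.liftQ k hk ∘ p.mkQ := by ext x; simp
    rw [heq]
    have : IsClosed (p : Set E) := hp
    exact (LinearMap.continuous_of_finiteDimensional _).comp p.mkQL.continuous
  have heq : (f : E → F) = fun x => k x + g (P x) := by
    ext x
    exact (sub_add_cancel (f x) (f (P x))).symm
  rw [heq]
  exact hkc.add (g.continuous.comp P.continuous)

end NormedSpace

section Derivation

open MulOpposite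

variable {A M : Type*} [CStarAlgebra A] [NormedAddCommGroup M] [NormedSpace ℂ M] [Module A M]

theorem isClosed_setOf_continuous_smul [IsScalarTower ℂ A M] [IsBoundedSMul A M]
    (D : A →ₗ[ℂ] M) :
    IsClosed {a : A | Continuous fun t => a • D t} := by
  refine isClosed_of_closure_subset fun a ha => ?_
  obtain ⟨x, hx, hlim⟩ := mem_closure_iff_seq_limit.1 ha
  let g (n : ℕ) : A →L[ℂ] M := ⟨x n • D, hx n⟩
  have h : Tendsto (fun n t => g n t) atTop (𝓝 fun t => a • D t) :=
    tendsto_pi_nhds.2 fun t => hlim.smul_const (D t)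
  exact (continuousLinearMapOfTendsto g h).continuous

variable [Module Aᵐᵒᵖ M] [SMulCommClass A Aᵐᵒᵖ M] [IsBoundedSMul Aᵐᵒᵖ M]

theorem continuous_mul_smul_of_continuous_smul {D : A →ₗ[ℂ] M}
    (hD : ∀ a b, D (a * b) = op b • D a + a • D b) {a : A} (ha : Continuous fun t => a • D t)
    (b : A) : Continuous fun t => (a * b) • D t := by
  have heq : (fun t => (a * b) • D t) = fun t => a • D (b * t) - op t • (a • D b) := by
    ext t
    rw [hD, smul_add, smul_comm a (op t), mul_smul]
    abel
  rw [heq]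
  exact (ha.comp (continuous_const_mul b)).sub (continuous_op.smul continuous_const)

variable [IsBoundedSMul A M]

/-- The star-closed ideal of those `a` for which both `t ↦ a • D t` and `t ↦ star a • D t` are
continuous. -/
def continuityIdeal (D : A →ₗ[ℂ] M)
    (hD : ∀ a b, D (a * b) = op b • D a + a • D b) : Ideal A where
  carrier := {a | (Continuous fun t => a • D t) ∧ Continuous fun t => star a • D t}
  zero_mem' := by simp [continuous_const]
  add_mem' := fun {a b} ha hb => by
    simp only [Set.mem_ofPred_eq, star_add, add_smul] at ha hb ⊢
    exact ⟨ha.1.add hb.1, ha.2.add hb.2⟩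
  smul_mem' := fun b a ha => by
    refine ⟨?_, ?_⟩
    · simp only [smul_eq_mul, mul_smul]
      exact ha.1.const_smul b
    · simp only [smul_eq_mul, star_mul]
      exact continuous_mul_smul_of_continuous_smul hD ha.2 (star b)

section

variable {D : A →ₗ[ℂ] M}
  (hD : ∀ a b, D (a * b) = op b • D a + a • D b)

theorem star_mem_continuityIdeal {a : A} (ha : a ∈ continuityIdeal D hD) :
    star a ∈ continuityIdeal D hD :=
  ⟨ha.2, by simpa using ha.1⟩

instance : (continuityIdeal D hD).IsTwoSided :=
  ⟨fun {a} b ha => by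
    have := (continuityIdeal D hD).mul_mem_left (star b) (star_mem_continuityIdeal hD ha)
    simpa using star_mem_continuityIdeal hD this⟩

variable [IsScalarTower ℂ A M]

theorem isClosed_continuityIdeal : IsClosed (continuityIdeal D hD : Set A) :=
  (isClosed_setOf_continuous_smul D).inter
    ((isClosed_setOf_continuous_smul D).preimage continuous_star)

theorem exists_bound_on_continuityIdeal :
    ∃ C : ℝ, ∀ x ∈ continuityIdeal D hD, ‖D x‖ ≤ C * ‖x‖ := by
  let _ := CStarAlgebra.spectralOrder A
  have _ := CStarAlgebra.spectralOrderedRing A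
  set J := continuityIdeal D hD
  have hJ : IsClosed (J : Set A) := isClosed_continuityIdeal hD
  by_contra! hunb
  have hy (n : ℕ) : ∃ y ∈ J, ‖y‖ ≤ (1 / 2) ^ n ∧ (n : ℝ) ≤ ‖D y‖ := by
    obtain ⟨x, hxJ, hx⟩ := hunb (n * 2 ^ n)
    have hx0 : 0 < ‖x‖ := by
      rw [norm_pos_iff]
      rintro rfl
      simp at hx
    refine ⟨((((1 / 2) ^ n / ‖x‖ : ℝ) : ℂ)) • x, ?_, ?_, ?_⟩
    · rw [← smul_one_mul]
      exact J.mul_mem_left _ hxJ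
    · rw [norm_smul, Complex.norm_of_nonneg (by positivity), div_mul_cancel₀ _ hx0.ne']
    · rw [map_smul, norm_smul, Complex.norm_of_nonneg (by positivity)]
      calc (n : ℝ) = (1 / 2) ^ n / ‖x‖ * (n * 2 ^ n * ‖x‖) := by
            field_simp
            rw [mul_assoc, ← mul_pow]; norm_num
        _ ≤ _ := by gcongr
  choose y hyJ hyn hDy using hy
  have hsum : Summable fun n => y n * star (y n) := by
    refine Summable.of_norm_bounded (g := fun n => (1 / 2 : ℝ) ^ n)
      (summable_geometric_of_lt_one (by norm_num) (by norm_num)) fun n => ?_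
    rw [CStarRing.norm_self_mul_star]
    have h1 : (1 / 2 : ℝ) ^ n ≤ 1 := pow_le_one₀ (by norm_num) (by norm_num)
    nlinarith [hyn n, norm_nonneg (y n)]
  obtain ⟨u, hu, hus, huJ⟩ := exists_nonneg_pow_four_eq hJ
    (tsum_nonneg fun n => mul_star_self_nonneg (y n))
    (tsum_mem hJ fun n => J.mul_mem_right (star (y n)) (hyJ n))
  choose c hc hcn using fun n => exists_eq_mul_of_mul_star_le_pow_four hu
    (show y n * star (y n) ≤ u ^ 4 from
      hus ▸ hsum.le_tsum n fun m _ => mul_star_self_nonneg (y m))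
  let T : A →L[ℂ] M := ⟨u • D, huJ.1⟩
  obtain ⟨n, hn⟩ := exists_nat_gt (‖u‖ * ‖D u‖ + ‖T‖ * ‖u‖)
  refine hn.not_ge ((hDy n).trans ?_)
  rw [hc n, hD]
  refine (norm_add_le _ _).trans (add_le_add ?_ ?_)
  · refine (norm_smul_le _ _).trans ?_
    rw [norm_op]
    gcongr
    exact hcn n
  · refine (T.le_opNorm (c n)).trans ?_
    gcongr
    exact hcn n

theorem exists_mul_self_mem_continuityIdeal (c : ℕ → A) (hc : ∀ n, IsSelfAdjoint (c n))
    (horth : ∀ m n, m ≠ n → c m * c n ∈ continuityIdeal D hD) :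
    ∃ n, c n * c n ∈ continuityIdeal D hD := by
  obtain ⟨C₀, hC₀⟩ := exists_bound_on_continuityIdeal hD
  obtain ⟨C, hCpos, hC⟩ : ∃ C : ℝ, 0 ≤ C ∧ ∀ x ∈ continuityIdeal D hD, ‖D x‖ ≤ C * ‖x‖ :=
    ⟨max C₀ 0, le_max_right _ _, fun x hx => (hC₀ x hx).trans (by gcongr; exact le_max_left _ _)⟩
  set J := continuityIdeal D hD
  have hJ : IsClosed (J : Set A) := isClosed_continuityIdeal hD
  by_contra! hnot
  have hnc (n : ℕ) : ¬ Continuous ((c n * c n) • D) := fun h =>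
    hnot n ⟨h, by rw [star_mul, (hc n).star_eq]; exact h⟩
  choose t ht hbig using fun n : ℕ => exists_large_of_not_continuous _ (hnc n)
    (δ := (1 / 2) ^ n / (1 + ‖c n‖)) (by positivity)
    (‖D (c n * c n)‖ + C * (‖c n‖ * 3) + 2 * ‖D (c n)‖ + n * (‖c n‖ + 1))
  have hp1 (n : ℕ) : (1 / 2 : ℝ) ^ n ≤ 1 := pow_le_one₀ (by norm_num) (by norm_num)
  have hct (n : ℕ) : ‖c n * t n‖ ≤ (1 / 2) ^ n := by
    calc ‖c n * t n‖ ≤ ‖c n‖ * ‖t n‖ := norm_mul_le _ _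
      _ ≤ (1 + ‖c n‖) * ((1 / 2) ^ n / (1 + ‖c n‖)) := by
          gcongr
          · linarith
          · exact ht n
      _ = (1 / 2) ^ n := by field_simp
  have ht1 (n : ℕ) : ‖t n‖ ≤ 1 := by
    refine (ht n).trans ((div_le_one (by positivity)).2 ((hp1 n).trans ?_))
    linarith [norm_nonneg (c n)]
  have hsum : Summable fun n => c n * t n :=
    Summable.of_norm_bounded (summable_geometric_of_lt_one (by norm_num) (by norm_num)) hct
  set v := ∑' n, c n * t n with hv
  have hv2 : ‖v‖ ≤ 2 := tsum_of_norm_bounded hasSum_geometric_two hct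
  have hrem (n : ℕ) : c n * v - c n * c n * t n ∈ J := by
    have h := (hsum.hasSum.update n 0).mul_left (c n)
    have heq : c n * v - c n * c n * t n = c n * (0 - c n * t n + v) := by noncomm_ring
    rw [heq, ← h.tsum_eq]
    refine tsum_mem hJ fun k => ?_
    by_cases hk : k = n
    · subst hk; simp
    · rw [Function.update_of_ne hk, ← mul_assoc]
      exact J.mul_mem_right _ (horth n k (Ne.symm hk))
  obtain ⟨n, hn⟩ := exists_nat_gt ‖D v‖
  have hD1 : (c n * c n) • D (t n) = c n • D v + op v • D (c n)
      - D (c n * v - c n * c n * t n) - op (t n) • D (c n * c n) := by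
    rw [map_sub, hD (c n) v, hD (c n * c n) (t n)]
    abel
  have hr : ‖D (c n * v - c n * c n * t n)‖ ≤ C * (‖c n‖ * 3) := by
    refine (hC _ (hrem n)).trans ?_
    gcongr
    rw [mul_assoc, ← mul_sub]
    refine (norm_mul_le _ _).trans ?_
    gcongr
    refine (norm_sub_le _ _).trans ?_
    linarith [(hct n).trans (hp1 n)]
  have h1 : ‖c n • D v‖ ≤ ‖c n‖ * ‖D v‖ := norm_smul_le _ _
  have h2 : ‖op v • D (c n)‖ ≤ 2 * ‖D (c n)‖ := by
    refine (norm_smul_le _ _).trans ?_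
    rw [norm_op]
    gcongr
  have h3 : ‖op (t n) • D (c n * c n)‖ ≤ ‖D (c n * c n)‖ := by
    refine (norm_smul_le _ _).trans ?_
    rw [norm_op]
    exact mul_le_of_le_one_left (norm_nonneg _) (ht1 n)
  have hle := hbig n
  rw [LinearMap.smul_apply, hD1] at hle
  have h4 := norm_sub_le (c n • D v + op v • D (c n) - D (c n * v - c n * c n * t n))
    (op (t n) • D (c n * c n))
  have h5 := norm_sub_le (c n • D v + op v • D (c n)) (D (c n * v - c n * c n * t n))
  have h6 := norm_add_le (c n • D v) (op v • D (c n))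
  nlinarith [norm_nonneg (c n), norm_nonneg (D v)]

end

/-- **Ringrose's theorem**: a derivation from a C⋆-algebra into a Banach bimodule is continuous. -/
theorem continuous_of_derivation [IsScalarTower ℂ A M] {D : A →ₗ[ℂ] M}
    (hD : ∀ a b, D (a * b) = op b • D a + a • D b) : Continuous D := by
  obtain ⟨C, hC⟩ := exists_bound_on_continuityIdeal hD
  have hfin : FiniteDimensional ℂ (A ⧸ continuityIdeal D hD) :=
    finiteDimensional_quotient_of_orthogonal _ (isClosed_continuityIdeal hD)
      (fun _ => star_mem_continuityIdeal hD) (exists_mul_self_mem_continuityIdeal hD)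
  have : FiniteDimensional ℂ (A ⧸ (continuityIdeal D hD).restrictScalars ℂ) := hfin
  exact continuous_of_bound_on_finite_codim D ((continuityIdeal D hD).restrictScalars ℂ)
    (isClosed_continuityIdeal hD) hC

end Derivation

/-- Theorem 2.7: every generalized derivation of the third type from a
C*-algebra into a Banach bimodule is automatically continuous. -/
theorem stmt_9 {A M : Type*} [NormedRing A] [StarRing A] [CStarRing A]
    [NormedAlgebra ℂ A] [CompleteSpace A] [StarModule ℂ A]
    [NormedAddCommGroup M] [NormedSpace ℂ M] [CompleteSpace M]
    [Module A M] [Module Aᵐᵒᵖ M] [SMulCommClass A Aᵐᵒᵖ M]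
    [IsScalarTower ℂ A M] [IsScalarTower ℂ Aᵐᵒᵖ M]
    (hbl : ∀ (a : A) (m : M), ‖a • m‖ ≤ ‖a‖ * ‖m‖)
    (hbr : ∀ (a : A) (m : M), ‖MulOpposite.op a • m‖ ≤ ‖a‖ * ‖m‖)
    (F : A →ₗ[ℂ] M) (G H : A → M)
    (hFGH : ∀ a b : A, F (a * b) = MulOpposite.op b • G a + a • H b) :
    Continuous F := by
  let _ : CStarAlgebra A := {}
  have : IsBoundedSMul A M := .of_norm_smul_le hbl
  have : IsBoundedSMul Aᵐᵒᵖ M := .of_norm_smul_le fun a m => hbr a.unop m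
  let R : A →ₗ[ℂ] M :=
    { toFun := fun a => MulOpposite.op a • F 1
      map_add' := fun a b => by rw [MulOpposite.op_add, add_smul]
      map_smul' := fun c a => by rw [MulOpposite.op_smul, smul_assoc, RingHom.id_apply] }
  have hG (a : A) : F a = G a + a • H 1 := by simpa using hFGH a 1
  have hH (b : A) : F b = MulOpposite.op b • G 1 + H b := by simpa using hFGH 1 b
  have hD (a b : A) : (F - R) (a * b) = MulOpposite.op b • (F - R) a + a • (F - R) b := by
    have hGa : G a = F a - a • H 1 := by rw [hG a, add_sub_cancel_right]
    have hHb : H b = F b - MulOpposite.op b • G 1 := by rw [hH b, add_sub_cancel_left]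
    have hF1 : F 1 = G 1 + H 1 := by simpa using hG 1
    simp only [LinearMap.sub_apply, R, LinearMap.coe_mk, AddHom.coe_mk]
    rw [hFGH, hGa, hHb, MulOpposite.op_mul, mul_smul, hF1]
    simp only [smul_sub, smul_add, smul_comm a (MulOpposite.op b)]
    abel
  have hR : Continuous R := MulOpposite.continuous_op.smul continuous_const
  have heq : (F : A → M) = fun a => (F - R) a + R a := by ext a; simp
  rw [heq]
  exact (continuous_of_derivation hD).add hR
end

section
/- Let A be a C*-algebra, M a Banach A-bimodule, and F : A → M a linear map such that there exist maps G, H : A → M with F(a∘b) = G(a)∘b + a∘H(b) for all a,b ∈ A, where x∘y = (xy+yx)/2 and a∘m = (am+ma)/2. Then F is continuous. -/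
open Filter Topology

universe u

section GlidingHump

variable {A M : Type*} [NormedAddCommGroup A] [NormedSpace ℂ A] [CompleteSpace A]
  [NormedAddCommGroup M] [NormedSpace ℂ M]

/-- The products `R 0 ∘ R 1 ∘ ⋯ ∘ R (n - 1)`. -/
def iterComp {E : Type*} [NormedAddCommGroup E] [NormedSpace ℂ E] (R : ℕ → E →L[ℂ] E) :
    ℕ → E →L[ℂ] E
  | 0 => ContinuousLinearMap.id ℂ E
  | n + 1 => (iterComp R n).comp (R n)

/-- A discontinuous linear map takes arbitrarily large values on arbitrarily small vectors. -/
theorem exists_large_of_not_continuous_s14 {E : Type*} [NormedAddCommGroup E] [NormedSpace ℂ E]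
    (f : E →ₗ[ℂ] M) (hf : ¬ Continuous f) {ε : ℝ} (hε : 0 < ε) (C : ℝ) :
    ∃ x, ‖x‖ ≤ ε ∧ C < ‖f x‖ := by
  by_contra! h
  refine hf (f.mkContinuousOfExistsBound ⟨C / ε, fun x => ?_⟩).continuous
  rcases eq_or_ne x 0 with rfl | hx
  · simp
  have hx' : 0 < ‖x‖ := norm_pos_iff.2 hx
  have := h (((ε / ‖x‖ : ℝ) : ℂ) • x) (by
    rw [norm_smul, Complex.norm_real, Real.norm_of_nonneg (by positivity)]
    field_simp; rfl)
  rw [map_smul, norm_smul, Complex.norm_real, Real.norm_of_nonneg (by positivity)] at this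
  rw [div_mul_eq_mul_div, le_div_iff₀ hε]
  rw [div_mul_eq_mul_div, div_le_iff₀ hx'] at this
  linarith

theorem exists_bound_of_continuous {E : Type*} [NormedAddCommGroup E] [NormedSpace ℂ E]
    (f : E →ₗ[ℂ] M) (hf : Continuous f) : ∃ C, ∀ x, ‖f x‖ ≤ C * ‖x‖ :=
  ⟨‖(⟨f, hf⟩ : E →L[ℂ] M)‖, fun x => (⟨f, hf⟩ : E →L[ℂ] M).le_opNorm x⟩

/-- Weighted series along a chain of contractions: its tails factor through the chain. -/
theorem exists_sum_iterComp (R : ℕ → A →L[ℂ] A) (hR : ∀ n a, ‖R n a‖ ≤ ‖a‖)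
    (b : ℕ → A) (hb : ∀ n, ‖b n‖ ≤ (1 / 2) ^ n) :
    ∃ x, ∀ n, ∃ z, ‖z‖ ≤ 2 ∧
      x = ∑ k ∈ Finset.range n, iterComp R k (b k) + iterComp R n z := by
  have key : ∀ k n, ‖iterComp (fun i => R (n + i)) k (b (n + k))‖ ≤ (1 / 2) ^ k := by
    have contr : ∀ (R : ℕ → A →L[ℂ] A), (∀ n a, ‖R n a‖ ≤ ‖a‖) → ∀ k a,
        ‖iterComp R k a‖ ≤ ‖a‖ := by
      intro R hR k
      induction k with
      | zero => intro a; simp [iterComp]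
      | succ k ih => intro a; exact (ih _).trans (hR _ _)
    intro k n
    refine (contr _ (fun _ _ => hR _ _) _ _).trans ((hb _).trans ?_)
    exact pow_le_pow_of_le_one (by norm_num) (by norm_num) (by omega)
  have hs : ∀ n, Summable fun k => iterComp (fun i => R (n + i)) k (b (n + k)) := fun n =>
    Summable.of_norm_bounded summable_geometric_two (fun k => key k n)
  have shift : ∀ (R : ℕ → A →L[ℂ] A) k a,
      iterComp R (k + 1) a = R 0 (iterComp (fun i => R (i + 1)) k a) := by
    intro R k
    induction k with
    | zero => intro a; simp [iterComp]
    | succ k ih => intro a; exact ih _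
  set z : ℕ → A := fun n => ∑' k, iterComp (fun i => R (n + i)) k (b (n + k)) with hz
  have hrec : ∀ n, z n = b n + R n (z (n + 1)) := by
    intro n
    simp only [hz]
    rw [(hs n).tsum_eq_zero_add, (R n).map_tsum (hs (n + 1))]
    congr 1
    refine tsum_congr fun k => ?_
    rw [shift]
    simp only [add_zero, add_assoc, add_comm 1]
  refine ⟨z 0, fun n => ⟨z n, ?_, ?_⟩⟩
  · exact tsum_of_norm_bounded hasSum_geometric_two (fun k => key k n)
  · induction n with
    | zero => simp [iterComp]
    | succ n ih =>
      rw [ih, Finset.sum_range_succ, hrec n, map_add, add_assoc]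
      rfl

/-- Stability lemma: along a chain of contractions, the continuity of `Q ∘ F ∘ R₀ ∘ ⋯ ∘ Rₙ`
eventually does not depend on `n`. -/
theorem eventually_continuous_comp_iterComp (F : A →ₗ[ℂ] M) (R : ℕ → A →L[ℂ] A)
    (hR : ∀ n a, ‖R n a‖ ≤ ‖a‖) :
    ∃ N, ∀ n ≥ N, ∀ Q : M →L[ℂ] M, Continuous (fun a => Q (F (iterComp R n a))) →
      Continuous (fun a => Q (F (iterComp R N a))) := by
  suffices h : ∃ N, ∀ n ≥ N, ∀ Q : M →L[ℂ] M,
      Continuous (fun a => Q (F (iterComp R (n + 1) a))) →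
        Continuous (fun a => Q (F (iterComp R n a))) by
    obtain ⟨N, hN⟩ := h
    refine ⟨N, fun n hn Q => ?_⟩
    induction n, hn using Nat.le_induction with
    | base => exact id
    | succ n hn ih => exact fun h => ih (hN n hn Q h)
  by_contra! hbad
  let lin (Q : M →L[ℂ] M) (n : ℕ) : A →ₗ[ℂ] M :=
    Q.toLinearMap ∘ₗ F ∘ₗ (iterComp R n).toLinearMap
  have step : ∀ (n : ℕ) (p : A), ∃ b : A, ‖b‖ ≤ (1 / 2) ^ n ∧
      ((∃ Q : M →L[ℂ] M, Continuous (lin Q (n + 1)) ∧ ¬ Continuous (lin Q n)) →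
        ∃ (Q : M →L[ℂ] M) (C : ℝ), (∀ a, ‖lin Q (n + 1) a‖ ≤ C * ‖a‖) ∧ 0 ≤ C ∧
          ‖Q‖ * n + 2 * C < ‖Q (F (p + iterComp R n b))‖) := by
    intro n p
    by_cases hn : ∃ Q : M →L[ℂ] M, Continuous (lin Q (n + 1)) ∧ ¬ Continuous (lin Q n)
    · obtain ⟨Q, h1, h2⟩ := hn
      obtain ⟨C, hC⟩ := exists_bound_of_continuous _ h1
      obtain ⟨b, hb, hb'⟩ := exists_large_of_not_continuous_s14 _ h2
        (ε := (1 / 2) ^ n) (by positivity) (‖Q‖ * n + 2 * |C| + ‖Q (F p)‖)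
      refine ⟨b, hb, fun _ => ⟨Q, |C|, fun a => (hC a).trans ?_, abs_nonneg _, ?_⟩⟩
      · exact mul_le_mul_of_nonneg_right (le_abs_self _) (norm_nonneg _)
      · rw [map_add, map_add]
        have : ‖lin Q n b‖ ≤ ‖Q (F p) + Q (F (iterComp R n b))‖ + ‖Q (F p)‖ := by
          refine le_trans (le_of_eq ?_) (norm_sub_le _ _)
          rw [add_sub_cancel_left]; rfl
        linarith
    · exact ⟨0, by simp, fun h => absurd h hn⟩
  choose β hβ1 hβ2 using step
  let p : ℕ → A := fun n => Nat.rec 0 (fun n q => q + iterComp R n (β n q)) n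
  have hp : ∀ n, p n = ∑ k ∈ Finset.range n, iterComp R k (β k (p k)) := by
    intro n
    induction n with
    | zero => simp [p]
    | succ n ih => rw [Finset.sum_range_succ, ← ih]
  obtain ⟨x, hx⟩ := exists_sum_iterComp R hR (fun n => β n (p n)) (fun n => hβ1 _ _)
  obtain ⟨N, hN⟩ := exists_nat_gt ‖F x‖
  obtain ⟨n, hn, Q, hQ1, hQ2⟩ := hbad N
  obtain ⟨Q, C, hC, hC0, hlarge⟩ := hβ2 n (p n) ⟨Q, hQ1, hQ2⟩
  obtain ⟨z, hz, hxz⟩ := hx (n + 1)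
  rw [Finset.sum_range_succ, ← hp] at hxz
  have h1 : Q (F (p n + iterComp R n (β n (p n)))) = Q (F x) - lin Q (n + 1) z := by
    conv_rhs => rw [hxz, map_add, map_add]
    exact (add_sub_cancel_right _ _).symm
  have h2 : ‖Q (F x)‖ ≤ ‖Q‖ * n := (Q.le_opNorm _).trans
    (mul_le_mul_of_nonneg_left (hN.le.trans (by exact_mod_cast hn)) (norm_nonneg _))
  have h3 : ‖lin Q (n + 1) z‖ ≤ 2 * C := (hC z).trans (by nlinarith)
  rw [h1] at hlarge
  linarith [norm_sub_le (Q (F x)) (lin Q (n + 1) z)]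

end GlidingHump

section AlmostJordan

variable {A M : Type*} [NormedRing A] [NormedAlgebra ℂ A]
  [NormedAddCommGroup M] [NormedSpace ℂ M]

/-- Continuous left and right actions `l`, `r` of `A` making `M` a bimodule, together with a linear
map `F` that is a Jordan derivation modulo continuous maps. -/
structure AlmostJordan (l r : A →L[ℂ] M →L[ℂ] M) (F : A →ₗ[ℂ] M) : Prop where
  l_one : ∀ m, l 1 m = m
  r_one : ∀ m, r 1 m = m
  l_mul : ∀ a b m, l (a * b) m = l a (l b m)
  r_mul : ∀ a b m, r (a * b) m = r b (r a m)
  l_r : ∀ a b m, r b (l a m) = l a (r b m)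
  jordan : ∀ a, Continuous fun x => F (a * x + x * a) - (l a (F x) + r a (F x))

namespace AlmostJordan

variable {l r : A →L[ℂ] M →L[ℂ] M} {F : A →ₗ[ℂ] M}

theorem triple (h : AlmostJordan l r F) (g f : A) :
    Continuous fun x => F (g * x * f + f * x * g) -
      (l g (r f (F x)) + l f (r g (F x))) := by
  have h1 : Continuous fun x => (2⁻¹ : ℂ) •
      ((F (g * (f * x + x * f) + (f * x + x * f) * g) -
          (l g (F (f * x + x * f)) + r g (F (f * x + x * f)))) +
        (l g (F (f * x + x * f) - (l f (F x) + r f (F x))) +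
          r g (F (f * x + x * f) - (l f (F x) + r f (F x)))) +
        (F (f * (g * x + x * g) + (g * x + x * g) * f) -
          (l f (F (g * x + x * g)) + r f (F (g * x + x * g)))) +
        (l f (F (g * x + x * g) - (l g (F x) + r g (F x))) +
          r f (F (g * x + x * g) - (l g (F x) + r g (F x)))) -
        (F ((g * f + f * g) * x + x * (g * f + f * g)) -
          (l (g * f + f * g) (F x) + r (g * f + f * g) (F x)))) := by
    have hg := h.jordan g
    have hf := h.jordan f
    refine continuous_const.smul (((((hg.comp (g := fun x => _)
      (f := fun x => f * x + x * f) (by fun_prop)).add ?_).add (hf.comp (g := fun x => _)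
      (f := fun x => g * x + x * g) (by fun_prop))).add ?_).sub (h.jordan _))
    · exact ((l g).continuous.comp hf).add ((r g).continuous.comp hf)
    · exact ((l f).continuous.comp hg).add ((r f).continuous.comp hg)
  refine h1.congr fun x => ?_
  have e : g * x * f + f * x * g = (2⁻¹ : ℂ) • ((g * (f * x + x * f) + (f * x + x * f) * g) +
      (f * (g * x + x * g) + (g * x + x * g) * f) -
      ((g * f + f * g) * x + x * (g * f + f * g))) := by
    rw [eq_inv_smul_iff₀ two_ne_zero, two_smul]
    noncomm_ring
  rw [e, map_smul]
  refine smul_right_injective M (two_ne_zero (α := ℂ)) ?_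
  simp only [map_add, map_sub, _root_.add_apply, h.l_mul, h.r_mul, h.l_r, smul_sub,
    smul_add, smul_inv_smul₀ (two_ne_zero (α := ℂ)), two_smul]
  abel

/-- If `F` intertwines each `R n` with `T n` up to continuous maps, the same holds for the
iterated products. -/
theorem _root_.continuous_intertwine_iterComp {F : A →ₗ[ℂ] M} {R : ℕ → A →L[ℂ] A}
    {T : ℕ → M →L[ℂ] M} (h : ∀ n, Continuous fun x => F (R n x) - T n (F x)) (n : ℕ) :
    Continuous fun x => F (iterComp R n x) - iterComp T n (F x) := by
  induction n with
  | zero => simpa [iterComp] using continuous_const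
  | succ n ih =>
    refine ((ih.comp (R n).continuous).add ((iterComp T n).continuous.comp (h n))).congr
      fun x => ?_
    simp [iterComp]

theorem continuous_comp_iterComp_iff {F : A →ₗ[ℂ] M} {R : ℕ → A →L[ℂ] A}
    {T : ℕ → M →L[ℂ] M} (h : ∀ n, Continuous fun x => F (R n x) - T n (F x)) (n : ℕ)
    (Q : M →L[ℂ] M) :
    Continuous (fun x => Q (F (iterComp R n x))) ↔
      Continuous (fun x => Q (iterComp T n (F x))) := by
  have h1 := Q.continuous.comp (continuous_intertwine_iterComp h n)
  constructor
  · exact fun h2 => (h2.sub h1).congr fun x => by simp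
  · exact fun h2 => (h2.add h1).congr fun x => by simp

/-- The ideal of all `a` such that `a • F` and `F • a` are continuous. -/
def contIdeal (h : AlmostJordan l r F) : Ideal A where
  carrier := {a | Continuous (fun x => l a (F x)) ∧ Continuous (fun x => r a (F x))}
  zero_mem' := by simp [continuous_const]
  add_mem' := by
    rintro a b ⟨ha, ha'⟩ ⟨hb, hb'⟩
    exact ⟨(ha.add hb).congr fun x => by simp, (ha'.add hb').congr fun x => by simp⟩
  smul_mem' := by
    rintro b a ⟨ha, ha'⟩
    refine ⟨((l b).continuous.comp ha).congr fun x => by simp [h.l_mul], ?_⟩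
    have h1 := ha'.comp (show Continuous fun x => b * x + x * b by fun_prop)
    have h2 := (r a).continuous.comp (h.jordan b)
    have h3 := (l b).continuous.comp ha'
    refine ((h1.sub h2).sub h3).congr fun x => ?_
    simp [h.r_mul, h.l_r]

theorem mul_mem_contIdeal (h : AlmostJordan l r F) {a : A} (b : A) (ha : a ∈ h.contIdeal) :
    a * b ∈ h.contIdeal := by
  obtain ⟨ha, ha'⟩ := ha
  refine ⟨?_, ((r b).continuous.comp ha').congr fun x => by simp [h.r_mul]⟩
  have h1 := ha.comp (show Continuous fun x => b * x + x * b by fun_prop)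
  have h2 := (l a).continuous.comp (h.jordan b)
  have h3 := (r b).continuous.comp ha
  refine ((h1.sub h2).sub h3).congr fun x => ?_
  simp [h.l_mul, h.l_r]

/-- The Jordan triple multiplication `x ↦ (g x f + f x g) / 2` on the algebra. -/
noncomputable def tripleAlg (g f : A) : A →L[ℂ] A :=
  (2⁻¹ : ℂ) • (ContinuousLinearMap.mulLeftRight ℂ A g f +
    ContinuousLinearMap.mulLeftRight ℂ A f g)

/-- The Jordan triple multiplication `m ↦ (g m f + f m g) / 2` on the module. -/
noncomputable def tripleMod (l r : A →L[ℂ] M →L[ℂ] M) (g f : A) : M →L[ℂ] M :=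
  (2⁻¹ : ℂ) • ((l g).comp (r f) + (l f).comp (r g))

theorem tripleMod_apply (g f : A) (m : M) :
    tripleMod l r g f m = (2⁻¹ : ℂ) • (l g (r f m) + l f (r g m)) := rfl

theorem norm_tripleAlg_le {g f : A} (hg : ‖g‖ ≤ 1) (hf : ‖f‖ ≤ 1) (a : A) :
    ‖tripleAlg g f a‖ ≤ ‖a‖ := by
  have key : ∀ u v : A, ‖u‖ ≤ 1 → ‖v‖ ≤ 1 → ‖u * a * v‖ ≤ ‖a‖ := by
    intro u v hu hv
    calc ‖u * a * v‖ ≤ ‖u‖ * ‖a‖ * ‖v‖ :=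
          (norm_mul_le _ _).trans (mul_le_mul_of_nonneg_right (norm_mul_le _ _) (norm_nonneg _))
      _ ≤ 1 * ‖a‖ * 1 := by gcongr
      _ = ‖a‖ := by ring
  have e : tripleAlg g f a = (2⁻¹ : ℂ) • (g * a * f + f * a * g) := rfl
  rw [e, norm_smul]
  have := norm_add_le (g * a * f) (f * a * g)
  have h1 := key g f hg hf
  have h2 := key f g hf hg
  simp only [norm_inv, RCLike.norm_ofNat]
  linarith

theorem intertwine_triple (h : AlmostJordan l r F) (g f : A) :
    Continuous fun x => F (tripleAlg g f x) - tripleMod l r g f (F x) := by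
  refine ((h.triple g f).const_smul (2⁻¹ : ℂ)).congr fun x => ?_
  have e : tripleAlg g f x = (2⁻¹ : ℂ) • (g * x * f + f * x * g) := rfl
  rw [e, tripleMod_apply, map_smul, ← smul_sub]
  rfl

theorem iterComp_tripleMod_self (h : AlmostJordan l r F) {G : ℕ → A}
    (hG : ∀ m n, m < n → G m * G n = G n ∧ G n * G m = G n) (n : ℕ) (m : M) :
    iterComp (fun k => tripleMod l r (G k) (G k)) (n + 1) m = l (G n) (r (G n) m) := by
  have self : ∀ (g : A) (m : M), tripleMod l r g g m = l g (r g m) := by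
    intro g m
    rw [tripleMod_apply, ← two_smul ℂ, inv_smul_smul₀ two_ne_zero]
  induction n generalizing m with
  | zero => exact self _ _
  | succ n ih =>
    change iterComp (fun k => tripleMod l r (G k) (G k)) (n + 1) (tripleMod l r _ _ m) = _
    rw [ih, self, h.l_r, ← h.l_mul, ← h.r_mul, (hG n (n + 1) (by omega)).1,
      (hG n (n + 1) (by omega)).2]

theorem left_iterComp_tripleMod (h : AlmostJordan l r F) {g : ℕ → A} {f : A}
    (hgf : ∀ k, g k * f = 0) {c : ℕ → A} {e : A} (hce : c 0 = e)
    (hc : ∀ n, c (n + 1) = c n * g n)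
    (hcf : e * f = 0) (n : ℕ) (m : M) :
    l e (iterComp (fun k => tripleMod l r (g k) f) n m) =
      (2⁻¹ : ℂ) ^ n • l (c n) (r (f ^ n) m) := by
  induction n generalizing m with
  | zero => simp [iterComp, h.r_one, hce]
  | succ n ih =>
    change l e (iterComp (fun k => tripleMod l r (g k) f) n (tripleMod l r _ _ m)) = _
    have hcn : c n * f = 0 := by
      cases n with
      | zero => rw [hce, hcf]
      | succ n => rw [hc, mul_assoc, hgf, mul_zero]
    rw [ih, tripleMod_apply, map_smul, map_smul, map_add, map_add, h.l_r, h.l_r, ← h.l_mul,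
      ← h.l_mul, hcn, ← h.r_mul, ← hc, ← pow_succ', smul_smul, ← pow_succ]
    simp

theorem right_iterComp_tripleMod (h : AlmostJordan l r F) {g : ℕ → A} {f : A}
    (hgf : ∀ k, f * g k = 0) {c : ℕ → A} {e : A} (hce : c 0 = e)
    (hc : ∀ n, c (n + 1) = g n * c n)
    (hcf : f * e = 0) (n : ℕ) (m : M) :
    r e (iterComp (fun k => tripleMod l r (g k) f) n m) =
      (2⁻¹ : ℂ) ^ n • l (f ^ n) (r (c n) m) := by
  induction n generalizing m with
  | zero => simp [iterComp, h.l_one, hce]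
  | succ n ih =>
    change r e (iterComp (fun k => tripleMod l r (g k) f) n (tripleMod l r _ _ m)) = _
    have hcn : f * c n = 0 := by
      cases n with
      | zero => rw [hce, hcf]
      | succ n => rw [hc, ← mul_assoc, hgf, zero_mul]
    rw [ih, tripleMod_apply, map_smul, map_smul, map_add, map_add, h.l_r, h.l_r, ← h.l_mul,
      ← h.l_mul, ← h.r_mul, ← h.r_mul, hcn, ← hc, ← pow_succ, smul_smul, ← pow_succ]
    simp

variable [CompleteSpace A]

theorem isClosed_contIdeal (h : AlmostJordan l r F) : IsClosed (h.contIdeal : Set A) := by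
  have key : ∀ (s : A →L[ℂ] M →L[ℂ] M) (u : ℕ → A) (a : A), Tendsto u atTop (𝓝 a) →
      (∀ n, Continuous fun x => s (u n) (F x)) → Continuous fun x => s a (F x) := by
    intro s u a hu hc
    refine (continuousLinearMapOfTendsto (σ₁₂ := RingHom.id ℂ) (l := atTop)
      (fun n => (⟨(s (u n)).toLinearMap ∘ₗ F, hc n⟩ : A →L[ℂ] M)) (f := fun x => s a (F x))
      (tendsto_pi_nhds.2 fun x => ?_)).continuous
    exact (((ContinuousLinearMap.apply ℂ M (F x)).continuous.comp s.continuous).tendsto a).comp hu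
  refine IsSeqClosed.isClosed fun u a hu hua => ⟨?_, ?_⟩
  · exact key l u a hua fun n => (hu n).1
  · exact key r u a hua fun n => (hu n).2

theorem exists_bound_sq (h : AlmostJordan l r F) :
    ∃ C, ∀ b ∈ h.contIdeal, ‖b‖ ≤ 1 → ‖F (b * b)‖ ≤ C := by
  let J : Submodule ℂ A := h.contIdeal.restrictScalars ℂ
  have : CompleteSpace J := h.isClosed_contIdeal.completeSpace_coe
  have hc : ∀ c ∈ h.contIdeal, Continuous fun x => F (c * x + x * c) := fun c hc =>
    ((h.jordan c).add (hc.1.add hc.2)).congr fun x => by simp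
  let B (c : J) : J →L[ℂ] M :=
    ⟨F ∘ₗ (LinearMap.mulLeft ℂ (c : A) + LinearMap.mulRight ℂ (c : A)) ∘ₗ J.subtype,
      (hc c c.2).comp continuous_subtype_val⟩
  have hB : ∀ c b : J, B c b = F ((c : A) * b + b * c) := fun c b => rfl
  obtain ⟨C, hC⟩ := banach_steinhaus (g := fun c : Metric.closedBall (0 : J) 1 => B c) (by
    intro b
    refine ⟨‖B b‖, fun c => ?_⟩
    have : B c b = B b c := by rw [hB, hB, add_comm]
    rw [this]
    exact (B b).le_of_opNorm_le_of_le le_rfl (mem_closedBall_zero_iff.1 c.2) |>.trans (by simp))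
  refine ⟨C, fun b hb hb1 => ?_⟩
  have h1 := hC ⟨⟨b, hb⟩, by simpa using hb1⟩
  have h2 := (B ⟨b, hb⟩).le_of_opNorm_le_of_le h1 (x := ⟨b, hb⟩) (b := 1) hb1
  rw [hB, ← two_smul ℂ, map_smul, norm_smul] at h2
  simp only [RCLike.norm_ofNat, mul_one] at h2
  linarith [norm_nonneg (F (b * b))]

/-- A decreasing chain of relative units is eventually constant modulo `contIdeal`. -/
theorem exists_sub_mem_contIdeal (h : AlmostJordan l r F) {G : ℕ → A}
    (hG : ∀ m n, m < n → G m * G n = G n ∧ G n * G m = G n) (hn : ∀ n, ‖G n‖ ≤ 1)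
    (hn' : ∀ n, ‖1 - G n‖ ≤ 1) : ∃ n, G n - G (n + 1) ∈ h.contIdeal := by
  obtain ⟨N, hN⟩ := eventually_continuous_comp_iterComp F (fun k => tripleAlg (G k) (G k))
    (fun k => norm_tripleAlg_le (hn k) (hn k))
  have corner : ∀ (Q : M →L[ℂ] M) (k : ℕ), N < k → (∀ m, Q (l (G k) (r (G k) m)) = 0) →
      Continuous fun x => Q (l (G N) (r (G N) (F x))) := by
    intro Q k hk hQ
    have hintw := fun n => h.intertwine_triple (G n) (G n)
    have h1 := hN (k + 1) (by omega) Q ((continuous_comp_iterComp_iff hintw _ Q).2 (by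
      simp only [h.iterComp_tripleMod_self hG, hQ]
      exact continuous_const))
    have h2 := (continuous_comp_iterComp_iff hintw (N + 1) Q).1
      (h1.comp (tripleAlg (G N) (G N)).continuous)
    simpa only [h.iterComp_tripleMod_self hG] using h2
  set f := 1 - G N with hf
  set g : ℕ → A := fun k => G (N + 1 + k) with hg
  have hgf : ∀ k, g k * f = 0 := fun k => by
    simp only [hg, hf, mul_sub, mul_one, (hG N (N + 1 + k) (by omega)).2, sub_self]
  have hfg : ∀ k, f * g k = 0 := fun k => by
    simp only [hg, hf, sub_mul, one_mul, (hG N (N + 1 + k) (by omega)).1, sub_self]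
  obtain ⟨K, hK⟩ := eventually_continuous_comp_iterComp F (fun k => tripleAlg (g k) f)
    (fun k => norm_tripleAlg_le (hn _) (hn' _))
  have hintw := fun n => h.intertwine_triple (g n) f
  set e := g K - g (K + 1) with he
  have hGe : ∀ i < N + 1 + K, G i * e = e := fun i hi => by
    rw [he, mul_sub, (hG i (N + 1 + K) (by omega)).1, (hG i (N + 1 + (K + 1)) (by omega)).1]
  have heG : ∀ i < N + 1 + K, e * G i = e := fun i hi => by
    rw [he, sub_mul, (hG i (N + 1 + K) (by omega)).2, (hG i (N + 1 + (K + 1)) (by omega)).2]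
  have hGe0 : ∀ i > N + 1 + (K + 1), G i * e = 0 := fun i hi => by
    rw [he, mul_sub, (hG (N + 1 + K) i (by omega)).2, (hG (N + 1 + (K + 1)) i (by omega)).2,
      sub_self]
  have heG0 : ∀ i > N + 1 + (K + 1), e * G i = 0 := fun i hi => by
    rw [he, sub_mul, (hG (N + 1 + K) i (by omega)).1, (hG (N + 1 + (K + 1)) i (by omega)).1,
      sub_self]
  have hgg : g K * g (K + 1) = g (K + 1) ∧ g (K + 1) * g K = g (K + 1) :=
    hG _ _ (by omega)
  have hfe : f * e = 0 := by rw [he, mul_sub, hfg, hfg, sub_self]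
  have hef : e * f = 0 := by rw [he, sub_mul, hgf, hgf, sub_self]
  refine ⟨N + 1 + K, ?_, ?_⟩
  · have hcorner : Continuous fun x => l e (r (G N) (F x)) := by
      refine (corner (l e) (N + 1 + (K + 2)) (by omega) fun m => ?_).congr fun x => ?_
      · rw [← h.l_mul, heG0 _ (by omega)]; simp
      · rw [← h.l_mul, heG _ (by omega)]
    obtain ⟨c, hce, hc⟩ : ∃ c : ℕ → A, c 0 = e ∧ ∀ n, c (n + 1) = c n * g n :=
      ⟨fun n => Nat.rec e (fun k x => x * g k) n, rfl, fun _ => rfl⟩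
    have hcK : ∀ n ≤ K, c n = e := by
      intro n hn
      induction n with
      | zero => exact hce
      | succ n ih => rw [hc, ih (by omega), heG _ (by omega)]
    have hc0 : c (K + 3) = 0 := by
      rw [show K + 3 = K + 1 + 1 + 1 from rfl, hc, hc, hc, hcK K le_rfl,
        mul_assoc e, hgg.1, mul_assoc,
        (hG (N + 1 + (K + 1)) (N + 1 + (K + 2)) (by omega)).1, heG0 _ (by omega)]
    have key := fun n m => h.left_iterComp_tripleMod hgf hce hc hef n m
    have h1 := (continuous_comp_iterComp_iff hintw K (l e)).1 <| hK (K + 3) (by omega) (l e)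
      ((continuous_comp_iterComp_iff hintw _ (l e)).2 (by
        simp only [key, hc0]
        simpa using continuous_const))
    simp only [key, hcK K le_rfl] at h1
    have h2 : Continuous fun x => l e (r (f ^ K) (F x)) :=
      (h1.const_smul ((2 : ℂ) ^ K)).congr fun x => by
        change (2 : ℂ) ^ K • ((2⁻¹ : ℂ) ^ K • (_ : M)) = _
        rw [smul_smul, ← mul_pow, mul_inv_cancel₀ two_ne_zero, one_pow, one_smul]
    have down : ∀ n, Continuous (fun x => l e (r (f ^ n) (F x))) →
        Continuous fun x => l e (F x) := by
      intro n
      induction n with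
      | zero => simp [h.r_one]
      | succ n ih =>
        refine fun h3 => ih ((h3.add ((r (f ^ n)).continuous.comp hcorner)).congr fun x => ?_)
        change _ + r (f ^ n) (l e (r (G N) (F x))) = _
        rw [h.l_r, ← h.r_mul, ← map_add, ← _root_.add_apply, ← map_add, pow_succ', ← add_mul,
          hf, sub_add_cancel, one_mul]
    exact down K h2
  · have hcorner : Continuous fun x => l (G N) (r e (F x)) := by
      refine (corner (r e) (N + 1 + (K + 2)) (by omega) fun m => ?_).congr fun x => ?_
      · rw [h.l_r, ← h.r_mul, hGe0 _ (by omega)]; simp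
      · rw [h.l_r, ← h.r_mul, hGe _ (by omega)]
    obtain ⟨c, hce, hc⟩ : ∃ c : ℕ → A, c 0 = e ∧ ∀ n, c (n + 1) = g n * c n :=
      ⟨fun n => Nat.rec e (fun k x => g k * x) n, rfl, fun _ => rfl⟩
    have hcK : ∀ n ≤ K, c n = e := by
      intro n hn
      induction n with
      | zero => exact hce
      | succ n ih => rw [hc, ih (by omega), hGe _ (by omega)]
    have hc0 : c (K + 3) = 0 := by
      rw [show K + 3 = K + 1 + 1 + 1 from rfl, hc, hc, hc, hcK K le_rfl,
        ← mul_assoc _ _ e, hgg.2, ← mul_assoc,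
        (hG (N + 1 + (K + 1)) (N + 1 + (K + 2)) (by omega)).2, hGe0 _ (by omega)]
    have key := fun n m => h.right_iterComp_tripleMod hfg hce hc hfe n m
    have h1 := (continuous_comp_iterComp_iff hintw K (r e)).1 <| hK (K + 3) (by omega) (r e)
      ((continuous_comp_iterComp_iff hintw _ (r e)).2 (by
        simp only [key, hc0]
        simpa using continuous_const))
    simp only [key, hcK K le_rfl] at h1
    have h2 : Continuous fun x => l (f ^ K) (r e (F x)) :=
      (h1.const_smul ((2 : ℂ) ^ K)).congr fun x => by
        change (2 : ℂ) ^ K • ((2⁻¹ : ℂ) ^ K • (_ : M)) = _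
        rw [smul_smul, ← mul_pow, mul_inv_cancel₀ two_ne_zero, one_pow, one_smul]
    have down : ∀ n, Continuous (fun x => l (f ^ n) (r e (F x))) →
        Continuous fun x => r e (F x) := by
      intro n
      induction n with
      | zero => simp [h.l_one]
      | succ n ih =>
        refine fun h3 => ih ((h3.add ((l (f ^ n)).continuous.comp hcorner)).congr fun x => ?_)
        change _ + l (f ^ n) (l (G N) (r e (F x))) = _
        rw [← h.l_mul, ← _root_.add_apply, ← map_add, pow_succ, ← mul_add,
          hf, sub_add_cancel, mul_one]
    exact down K h2

end AlmostJordan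
end AlmostJordan
section CStarIdeal

variable {A : Type u} [CStarAlgebra A] {I : Ideal A}

/-- A self-adjoint element of a left ideal that is an approximate right unit for `b`. -/
theorem Ideal.exists_norm_mul_one_sub_le {b : A} (hb : star b * b ∈ I) {δ : ℝ} (hδ : 0 < δ) :
    ∃ u ∈ I, IsSelfAdjoint u ∧ ‖1 - u‖ ≤ 1 ∧ ‖b * (1 - u)‖ ^ 2 ≤ δ := by
  set c := star b * b with hc
  have hcs : IsSelfAdjoint c := .star_mul_self b
  have hpos : ∀ t ∈ spectrum ℝ c, 0 ≤ t := fun t ht => spectrum_star_mul_self_nonneg t ht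
  have hne : ∀ t ∈ spectrum ℝ c, δ + t ≠ 0 := fun t ht => by linarith [hpos t ht]
  have hcont : ContinuousOn (fun t : ℝ => (δ + t)⁻¹) (spectrum ℝ c) :=
    ContinuousOn.inv₀ (by fun_prop) hne
  have hcont' : ContinuousOn (fun t : ℝ => δ * (δ + t)⁻¹) (spectrum ℝ c) :=
    continuousOn_const.mul hcont
  have hcont'' : ContinuousOn (fun t : ℝ => (δ + t)⁻¹ * t) (spectrum ℝ c) :=
    hcont.mul continuousOn_id
  have hv : 1 - cfc (fun t : ℝ => (δ + t)⁻¹ * t) c = cfc (fun t : ℝ => δ * (δ + t)⁻¹) c := by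
    rw [← cfc_one ℝ c, ← cfc_sub 1 _ c continuousOn_const hcont'']
    refine cfc_congr fun t ht => ?_
    have := hne t ht
    simp only [Pi.one_apply]
    field_simp
    ring
  have hvs : IsSelfAdjoint (cfc (fun t : ℝ => δ * (δ + t)⁻¹) c) := cfc_predicate _ c
  refine ⟨cfc (fun t : ℝ => (δ + t)⁻¹ * t) c, ?_, cfc_predicate _ c, ?_, ?_⟩
  · rw [cfc_mul _ (fun t => t) c hcont continuousOn_id, cfc_id' ℝ c]
    exact I.mul_mem_left _ hb
  · rw [hv]
    refine norm_cfc_le zero_le_one fun t ht => ?_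
    have := hpos t ht
    rw [Real.norm_of_nonneg (by positivity), ← div_eq_mul_inv]
    exact div_le_one_of_le₀ (by linarith) (by linarith)
  · rw [hv, sq, ← CStarRing.norm_star_mul_self, star_mul, hvs.star_eq, mul_assoc,
      ← mul_assoc (star b), ← hc]
    nth_rw 2 [← cfc_id' ℝ c]
    rw [← cfc_mul (fun t => t) _ c continuousOn_id hcont',
      ← cfc_mul _ (fun t => t * (δ * (δ + t)⁻¹)) c hcont' (continuousOn_id.mul hcont')]
    refine norm_cfc_le hδ.le fun t ht => ?_
    have := hpos t ht
    rw [Real.norm_of_nonneg (by positivity)]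
    have h1 : δ * (δ + t)⁻¹ ≤ 1 := by
      rw [← div_eq_mul_inv]
      exact div_le_one_of_le₀ (by linarith) (by linarith)
    have h2 : t * (δ + t)⁻¹ ≤ 1 := by
      rw [← div_eq_mul_inv]
      exact div_le_one_of_le₀ (by linarith) (by linarith)
    calc δ * (δ + t)⁻¹ * (t * (δ * (δ + t)⁻¹))
        = (δ * (δ + t)⁻¹) * (t * (δ + t)⁻¹) * δ := by ring
      _ ≤ 1 * 1 * δ := by gcongr
      _ = δ := by ring

theorem Ideal.mem_of_star_mul_self_mem [I.IsTwoSided] (hI : IsClosed (I : Set A)) {b : A}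
    (hb : star b * b ∈ I) : b ∈ I := by
  refine hI.closure_subset (Metric.mem_closure_iff.2 fun ε hε => ?_)
  obtain ⟨u, hu, -, -, h⟩ := I.exists_norm_mul_one_sub_le hb (δ := ε ^ 2 / 2) (by positivity)
  refine ⟨b * u, I.mul_mem_left _ hu, ?_⟩
  rw [dist_eq_norm, show b - b * u = b * (1 - u) by noncomm_ring]
  exact lt_of_pow_lt_pow_left₀ 2 hε.le (by nlinarith)

theorem Ideal.star_mem_of_mem [I.IsTwoSided] (hI : IsClosed (I : Set A)) {b : A} (hb : b ∈ I) :
    star b ∈ I :=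
  I.mem_of_star_mul_self_mem hI (by rw [star_star]; exact I.mul_mem_right _ hb)

/-- The quotient of a C⋆-algebra by a closed two-sided ideal is a C⋆-algebra. -/
theorem Ideal.exists_cstarAlgebra_quotient [I.IsTwoSided] (hI : IsClosed (I : Set A)) :
    ∃ (Q : Type u) (_ : CStarAlgebra Q) (π : A →⋆ₐ[ℂ] Q),
      Function.Surjective π ∧ ∀ a, π a = 0 ↔ a ∈ I := by
  have : IsClosed (I : Set A) := hI
  let mk : A →+* A ⧸ I := Ideal.Quotient.mk I
  have mk_surj : Function.Surjective mk := Ideal.Quotient.mk_surjective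
  have mk_eq : ∀ {a b : A}, mk a = mk b ↔ a - b ∈ I := Ideal.Quotient.eq
  have mk_le : ∀ a, ‖mk a‖ ≤ ‖a‖ := Submodule.Quotient.norm_mk_le I
  have mk_lt : ∀ (x : A ⧸ I) {ε : ℝ}, 0 < ε → ∃ a, mk a = x ∧ ‖a‖ < ‖x‖ + ε :=
    fun x _ hε => Submodule.Quotient.norm_mk_lt x hε
  let : NormedRing (A ⧸ I) :=
    { Submodule.Quotient.normedAddCommGroup I, Ideal.Quotient.ring I with
      norm_mul_le := fun x y => by
        have hlim : Tendsto (fun ε : ℝ => (‖x‖ + ε) * (‖y‖ + ε)) (𝓝[>] 0) (𝓝 (‖x‖ * ‖y‖)) := by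
          refine tendsto_nhdsWithin_of_tendsto_nhds ?_
          have : Continuous fun ε : ℝ => (‖x‖ + ε) * (‖y‖ + ε) := by fun_prop
          simpa using this.tendsto 0
        refine ge_of_tendsto hlim (eventually_mem_nhdsWithin.mono fun ε hε => ?_)
        obtain ⟨a, rfl, ha⟩ := mk_lt x hε
        obtain ⟨b, rfl, hb⟩ := mk_lt y hε
        rw [← map_mul]
        refine (mk_le _).trans ((norm_mul_le a b).trans ?_)
        exact mul_le_mul ha.le hb.le (norm_nonneg _) ((norm_nonneg _).trans ha.le) }
  let : NormedAlgebra ℂ (A ⧸ I) :=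
    { Submodule.Quotient.normedSpace I ℂ, Ideal.Quotient.algebra ℂ with }
  let : Star (A ⧸ I) := ⟨fun x => Quotient.liftOn' x (fun a => mk (star a)) fun a b hab => by
    have hab' : a - b ∈ I := mk_eq.1 (Quotient.sound' hab)
    rw [mk_eq, ← star_sub]
    exact I.star_mem_of_mem hI hab'⟩
  have mk_star : ∀ a, mk (star a) = star (mk a) := fun _ => rfl
  let : StarRing (A ⧸ I) :=
    { star_involutive := fun x => by
        obtain ⟨a, rfl⟩ := mk_surj x
        rw [← mk_star, ← mk_star, star_star]
      star_mul := fun x y => by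
        obtain ⟨a, rfl⟩ := mk_surj x
        obtain ⟨b, rfl⟩ := mk_surj y
        rw [← map_mul, ← mk_star, ← mk_star, ← mk_star, star_mul, map_mul]
      star_add := fun x y => by
        obtain ⟨a, rfl⟩ := mk_surj x
        obtain ⟨b, rfl⟩ := mk_surj y
        rw [← map_add, ← mk_star, ← mk_star, ← mk_star, star_add, map_add] }
  let : CStarAlgebra (A ⧸ I) :=
    { toCompleteSpace := Submodule.Quotient.completeSpace I
      norm_mul_self_le := fun x => by
        obtain ⟨a, rfl⟩ := mk_surj x
        refine le_of_forall_pos_le_add fun ε hε => ?_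
        obtain ⟨d, hd, hdlt⟩ := mk_lt (star (mk a) * mk a) (half_pos hε)
        have hj : star a * a - d ∈ I := by
          rw [← mk_eq, hd, map_mul, mk_star]
        obtain ⟨u, hu, hus, hu1, hu2⟩ := I.exists_norm_mul_one_sub_le
          (I.mul_mem_left (star (star a * a - d)) hj) (δ := (ε / 2) ^ 2) (by positivity)
        have hu3 := le_of_sq_le_sq hu2 (by positivity)
        have hmk : mk a = mk (a * (1 - u)) := by
          rw [mk_eq, show a - a * (1 - u) = a * u by noncomm_ring]
          exact I.mul_mem_left _ hu
        have hsplit : star (a * (1 - u)) * (a * (1 - u)) =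
            (1 - u) * (d * (1 - u) + (star a * a - d) * (1 - u)) := by
          rw [star_mul, star_sub, star_one, hus.star_eq]
          noncomm_ring
        calc ‖mk a‖ * ‖mk a‖ ≤ ‖a * (1 - u)‖ * ‖a * (1 - u)‖ := by
              rw [hmk]; gcongr <;> exact mk_le _
          _ = ‖(1 - u) * (d * (1 - u) + (star a * a - d) * (1 - u))‖ := by
              rw [← CStarRing.norm_star_mul_self, hsplit]
          _ ≤ 1 * (‖d‖ * 1 + ε / 2) := by
              refine (norm_mul_le _ _).trans (mul_le_mul hu1 ?_ (norm_nonneg _) zero_le_one)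
              refine (norm_add_le _ _).trans (add_le_add ?_ hu3)
              exact (norm_mul_le _ _).trans (by gcongr)
          _ ≤ _ := by linarith
      star_smul := fun c x => by
        obtain ⟨a, rfl⟩ := mk_surj x
        change mk (star (c • a)) = star c • mk (star a)
        rw [star_smul]
        rfl }
  let π : A →⋆ₐ[ℂ] A ⧸ I := { Ideal.Quotient.mkₐ ℂ I with map_star' := mk_star }
  exact ⟨A ⧸ I, inferInstance, π, mk_surj, fun a => Ideal.Quotient.eq_zero_iff_mem⟩

end CStarIdeal

section FiniteSpectrum

variable {A : Type u} [CStarAlgebra A]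

theorem exists_infinite_spectrum_of_orthogonal {p : ℕ → A} (hp : ∀ n, IsStarProjection (p n))
    (hne : ∀ n, p n ≠ 0) (horth : ∀ m n, m ≠ n → p m * p n = 0) :
    ∃ h : A, IsSelfAdjoint h ∧ (spectrum ℝ h).Infinite := by
  have hsum : Summable fun n => ((2⁻¹ : ℝ) ^ n) • p n := by
    refine Summable.of_norm_bounded (summable_geometric_of_lt_one (r := (2⁻¹ : ℝ))
      (by norm_num) (by norm_num)) fun n => ?_
    rw [norm_smul, Real.norm_of_nonneg (by positivity)]
    exact mul_le_of_le_one_right (by positivity) (IsStarProjection.norm_le _ (hp n))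
  refine ⟨∑' n, ((2⁻¹ : ℝ) ^ n) • p n, ?_, ?_⟩
  · rw [IsSelfAdjoint, tsum_star]
    exact tsum_congr fun n => by rw [star_smul, (hp n).isSelfAdjoint.star_eq, star_trivial]
  · have heig : ∀ n, (∑' n, ((2⁻¹ : ℝ) ^ n) • p n) * p n = ((2⁻¹ : ℝ) ^ n) • p n := fun n => by
      rw [← hsum.tsum_mul_right, tsum_eq_single n fun m hm => by
        rw [smul_mul_assoc, horth m n hm, smul_zero], smul_mul_assoc, (hp n).isIdempotentElem.eq]
    refine Set.infinite_of_injective_forall_mem (f := fun n : ℕ => (2⁻¹ : ℝ) ^ n)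
      (pow_right_injective₀ (by norm_num) (by norm_num)) fun n => ?_
    rw [spectrum.mem_iff]
    refine fun hu => hne n (hu.mul_right_eq_zero.1 ?_)
    rw [sub_mul, heig, Algebra.algebraMap_eq_smul_one, smul_mul_assoc, one_mul, sub_self]

/-- Strict order on star projections. -/
def ProjLT (p q : A) : Prop :=
  IsStarProjection p ∧ IsStarProjection q ∧ q * p = p ∧ p * q = p ∧ p ≠ q

theorem wellFounded_projLT (hfin : ∀ h : A, IsSelfAdjoint h → (spectrum ℝ h).Finite) :
    WellFounded (ProjLT (A := A)) := by
  rw [wellFounded_iff_isEmpty_descending_chain]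
  refine ⟨fun ⟨p, hp⟩ => ?_⟩
  have hle : ∀ m n, m ≤ n → p m * p n = p n ∧ p n * p m = p n := by
    intro m n hmn
    induction n, hmn using Nat.le_induction with
    | base => exact ⟨(hp m).2.1.isIdempotentElem.eq, (hp m).2.1.isIdempotentElem.eq⟩
    | succ n hmn ih =>
      obtain ⟨-, -, h1, h2, -⟩ := hp n
      constructor
      · rw [← h1, ← mul_assoc, ih.1]
      · rw [← h2, mul_assoc, ih.2]
  have hlt : ∀ m n, m < n → (p m - p (m + 1)) * (p n - p (n + 1)) = 0 ∧
      (p n - p (n + 1)) * (p m - p (m + 1)) = 0 := fun m n hmn => by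
    simp only [sub_mul, mul_sub, (hle m n hmn.le).1, (hle m n hmn.le).2,
      (hle m (n + 1) (by omega)).1, (hle m (n + 1) (by omega)).2, (hle (m + 1) n hmn).1,
      (hle (m + 1) n hmn).2, (hle (m + 1) (n + 1) (by omega)).1,
      (hle (m + 1) (n + 1) (by omega)).2, sub_self, and_self]
  obtain ⟨h, hs, hinf⟩ := exists_infinite_spectrum_of_orthogonal
    (p := fun n => p n - p (n + 1))
    (fun n => (hp n).1.sub_of_mul_eq_left (hp n).2.1 (hp n).2.2.2.1)
    (fun n => sub_ne_zero.2 (hp n).2.2.2.2.symm)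
    (fun m n hmn => hmn.lt_or_gt.elim (fun h => (hlt m n h).1) fun h => (hlt n m h).2)
  exact hinf (hfin h hs)

theorem exists_projLT_or_scalar (hfin : ∀ h : A, IsSelfAdjoint h → (spectrum ℝ h).Finite)
    {p : A} (hp : IsStarProjection p) :
    (∃ e, ProjLT e p ∧ e ≠ 0) ∨ ∀ x, p * x = x → x * p = x → ∃ c : ℂ, x = c • p := by
  rw [or_iff_not_imp_left]
  intro hmin
  have hmin : ∀ e, IsStarProjection e → p * e = e → e * p = e → e = 0 ∨ e = p := by
    intro e he h1 h2
    by_contra! hcon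
    exact hmin ⟨e, ⟨he, hp, h1, h2, hcon.2⟩, hcon.1⟩
  have hsa : ∀ x, IsSelfAdjoint x → p * x = x → x * p = x → ∃ c : ℂ, x = c • p := by
    intro x hx h1 h2
    classical
    let χ : ℝ → ℝ → ℝ := fun μ t => if t = μ then 1 else 0
    have hcont : ∀ f : ℝ → ℝ, ContinuousOn f (spectrum ℝ x) := (hfin x hx).continuousOn
    have hχ : ∀ μ : ℝ, ∃ c : ℂ, μ • cfc (χ μ) x = c • p := by
      intro μ
      by_cases hμ : μ = 0
      · exact ⟨0, by simp [hμ]⟩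
      have hx1 : cfc (χ μ) x = x * cfc (fun t => μ⁻¹ * χ μ t) x := by
        nth_rw 2 [← cfc_id' ℝ x]
        rw [← cfc_mul _ _ x (hcont _) (hcont _)]
        refine cfc_congr fun t _ => ?_
        by_cases ht : t = μ <;> simp [χ, ht, hμ]
      have hx2 : cfc (χ μ) x = cfc (fun t => μ⁻¹ * χ μ t) x * x := by
        nth_rw 3 [← cfc_id' ℝ x]
        rw [← cfc_mul _ _ x (hcont _) (hcont _)]
        refine cfc_congr fun t _ => ?_
        by_cases ht : t = μ <;> simp [χ, ht, hμ]
      have hproj : IsStarProjection (cfc (χ μ) x) := by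
        refine ⟨?_, cfc_predicate _ x⟩
        rw [IsIdempotentElem, ← cfc_mul _ _ x (hcont _) (hcont _)]
        refine cfc_congr fun t _ => ?_
        by_cases ht : t = μ <;> simp [χ, ht]
      rcases hmin _ hproj (by rw [hx1, ← mul_assoc, h1]) (by rw [hx2, mul_assoc, h2]) with h | h
      · exact ⟨0, by simp [h]⟩
      · exact ⟨μ, by rw [h, Complex.coe_smul]⟩
    choose c hc using hχ
    refine ⟨∑ μ ∈ (hfin x hx).toFinset, c μ, ?_⟩
    rw [Finset.sum_smul, ← Finset.sum_congr rfl fun μ _ => hc μ]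
    have : ∀ μ, μ • cfc (χ μ) x = cfc (fun t => μ * χ μ t) x := fun μ =>
      (cfc_const_mul μ (χ μ) x (hcont _)).symm
    simp only [this]
    rw [← cfc_sum _ x _ fun _ _ => hcont _]
    nth_rw 1 [← cfc_id' ℝ x]
    refine cfc_congr fun t ht => ?_
    simp [χ, ht]
  intro x h1 h2
  have h3 : star x * p = star x := by
    conv_lhs => rw [← hp.isSelfAdjoint.star_eq, ← star_mul, h1]
  have h4 : p * star x = star x := by
    conv_lhs => rw [← hp.isSelfAdjoint.star_eq, ← star_mul, h2]
  obtain ⟨c, hc⟩ := hsa (x + star x) (.add_star_self x) (by rw [mul_add, h1, h4])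
    (by rw [add_mul, h2, h3])
  obtain ⟨d, hd⟩ := hsa (Complex.I • (x - star x))
    (by rw [IsSelfAdjoint, star_smul, star_sub, star_star, Complex.star_def, Complex.conj_I,
          neg_smul, ← smul_neg, neg_sub])
    (by rw [mul_smul_comm, mul_sub, h1, h4]) (by rw [smul_mul_assoc, sub_mul, h2, h3])
  refine ⟨2⁻¹ * (c - Complex.I * d), ?_⟩
  rw [mul_smul, sub_smul, mul_smul, ← hc, ← hd, smul_smul, Complex.I_mul_I, neg_one_smul,
    sub_neg_eq_add, add_add_sub_cancel, ← two_smul ℂ, inv_smul_smul₀ two_ne_zero]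

/-- The subspace `p A r` for idempotents `p` and `r`. -/
def cornerSubmodule (p r : A) : Submodule ℂ A where
  carrier := {x | p * x = x ∧ x * r = x}
  zero_mem' := by simp
  add_mem' := fun ⟨h1, h2⟩ ⟨h3, h4⟩ => ⟨by rw [mul_add, h1, h3], by rw [add_mul, h2, h4]⟩
  smul_mem' := fun c x ⟨h1, h2⟩ => ⟨by rw [mul_smul_comm, h1], by rw [smul_mul_assoc, h2]⟩

theorem finiteDimensional_cornerSubmodule_of_scalar {p r : A}
    (hp : IsStarProjection p) (hr : IsStarProjection r)
    (hps : ∀ x, p * x = x → x * p = x → ∃ c : ℂ, x = c • p)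
    (hrs : ∀ x, r * x = x → x * r = x → ∃ c : ℂ, x = c • r) :
    FiniteDimensional ℂ (cornerSubmodule p r) := by
  by_cases h0 : ∃ x ∈ cornerSubmodule p r, x ≠ 0
  swap
  · push Not at h0
    rw [(Submodule.eq_bot_iff _).2 h0]
    infer_instance
  obtain ⟨x, ⟨h1, h2⟩, hx⟩ := h0
  have h3 : star x * p = star x := by
    conv_lhs => rw [← hp.isSelfAdjoint.star_eq, ← star_mul, h1]
  have h4 : r * star x = star x := by
    conv_lhs => rw [← hr.isSelfAdjoint.star_eq, ← star_mul, h2]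
  obtain ⟨c, hc⟩ := hrs (star x * x) (by rw [← mul_assoc, h4]) (by rw [mul_assoc, h2])
  have hc0 : c ≠ 0 := by
    rintro rfl
    rw [zero_smul] at hc
    exact hx (CStarRing.star_mul_self_eq_zero_iff x |>.1 hc)
  refine Submodule.finiteDimensional_of_le (S₂ := ℂ ∙ x) ?_
  rintro y ⟨h5, h6⟩
  obtain ⟨d, hd⟩ := hps (y * star x) (by rw [← mul_assoc, h5]) (by rw [mul_assoc, h3])
  refine Submodule.mem_span_singleton.2 ⟨c⁻¹ * d, ?_⟩
  rw [mul_smul, inv_smul_eq_iff₀ hc0]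
  calc d • x = y * star x * x := by rw [hd, smul_mul_assoc, h1]
    _ = c • y := by rw [mul_assoc, hc, mul_smul_comm, h6]

/-- A C⋆-algebra whose self-adjoint elements have finite spectrum is finite dimensional. -/
theorem finiteDimensional_of_finite_spectrum
    (hfin : ∀ h : A, IsSelfAdjoint h → (spectrum ℝ h).Finite) : FiniteDimensional ℂ A := by
  have hwf := wellFounded_projLT hfin
  have hcompl : ∀ {e p : A}, ProjLT e p → e ≠ 0 → ProjLT (p - e) p := by
    rintro e p ⟨he, hp, h1, h2, h3⟩ h0
    exact ⟨he.sub_of_mul_eq_left hp h2, hp, by rw [mul_sub, hp.isIdempotentElem.eq, h1],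
      by rw [sub_mul, hp.isIdempotentElem.eq, h2], fun h => h0 (sub_eq_self.1 h)⟩
  have hall : ∀ p : A, IsStarProjection p → ∀ r : A, IsStarProjection r →
      FiniteDimensional ℂ (cornerSubmodule p r) := by
    intro p
    induction p using hwf.induction with
    | _ p ihp =>
    intro hp
    rcases exists_projLT_or_scalar hfin hp with ⟨e, he, he0⟩ | hps
    · intro r hr
      have := ihp e he he.1 r hr
      have := ihp (p - e) (hcompl he he0) (hcompl he he0).1 r hr
      refine Submodule.finiteDimensional_of_le
        (S₂ := cornerSubmodule e r ⊔ cornerSubmodule (p - e) r) ?_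
      rintro x ⟨h1, h2⟩
      refine Submodule.mem_sup.2 ⟨e * x, ⟨?_, ?_⟩, (p - e) * x, ⟨?_, ?_⟩, ?_⟩
      · rw [← mul_assoc, he.1.isIdempotentElem.eq]
      · rw [mul_assoc, h2]
      · rw [← mul_assoc, (hcompl he he0).1.isIdempotentElem.eq]
      · rw [mul_assoc, h2]
      · rw [sub_mul, h1, add_sub_cancel]
    · intro r
      induction r using hwf.induction with
      | _ r ihr =>
      intro hr
      rcases exists_projLT_or_scalar hfin hr with ⟨e, he, he0⟩ | hrs
      · have := ihr e he he.1
        have := ihr (r - e) (hcompl he he0) (hcompl he he0).1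
        refine Submodule.finiteDimensional_of_le
          (S₂ := cornerSubmodule p e ⊔ cornerSubmodule p (r - e)) ?_
        rintro x ⟨h1, h2⟩
        refine Submodule.mem_sup.2 ⟨x * e, ⟨?_, ?_⟩, x * (r - e), ⟨?_, ?_⟩, ?_⟩
        · rw [← mul_assoc, h1]
        · rw [mul_assoc, he.1.isIdempotentElem.eq]
        · rw [← mul_assoc, h1]
        · rw [mul_assoc, (hcompl he he0).1.isIdempotentElem.eq]
        · rw [mul_sub, h2, add_sub_cancel]
      · exact finiteDimensional_cornerSubmodule_of_scalar hp hr hps hrs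
  have := hall 1 (.one A) 1 (.one A)
  have htop : cornerSubmodule (1 : A) 1 = ⊤ := by
    ext x; simp [cornerSubmodule]
  rw [htop] at this
  exact Submodule.topEquiv.finiteDimensional

end FiniteSpectrum

namespace AlmostJordan

open scoped CStarAlgebra

variable {A : Type u} {M : Type*} [CStarAlgebra A] [NormedAddCommGroup M] [NormedSpace ℂ M]
  {l r : A →L[ℂ] M →L[ℂ] M} {F : A →ₗ[ℂ] M}

theorem isTwoSided_contIdeal (h : AlmostJordan l r F) : h.contIdeal.IsTwoSided :=
  ⟨fun b ha => h.mul_mem_contIdeal b ha⟩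

variable {Q : Type*} [CStarAlgebra Q] {π : A →⋆ₐ[ℂ] Q}

theorem not_mem_spectrum_of_strictAnti (h : AlmostJordan l r F) (hπ : Function.Surjective π)
    (hker : ∀ a, π a = 0 ↔ a ∈ h.contIdeal) {q : Q} (hq : IsSelfAdjoint q) {t : ℕ → ℝ}
    (ht : StrictAnti t) : ∃ n, t n ∉ spectrum ℝ q := by
  by_contra! hmem
  obtain ⟨a, ha, rfl⟩ : ∃ a, IsSelfAdjoint a ∧ π a = q := by
    obtain ⟨b, rfl⟩ := hπ q
    refine ⟨(2⁻¹ : ℂ) • (b + star b), ?_, ?_⟩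
    · exact IsSelfAdjoint.smul (by simp [IsSelfAdjoint]) (.add_star_self b)
    · rw [map_smul, map_add, map_star, hq.star_eq, ← two_smul ℂ, inv_smul_smul₀ two_ne_zero]
  let g : ℕ → ℝ → ℝ := fun n x => max 0 (min 1 ((t n - x) / (t n - t (n + 1))))
  have hpos : ∀ n, 0 < t n - t (n + 1) := fun n => sub_pos.2 (ht n.lt_succ_self)
  have hcont : ∀ n, Continuous (g n) := fun n => by fun_prop
  have hg0 : ∀ n x, 0 ≤ g n x := fun n x => le_max_left _ _
  have hg1 : ∀ n x, g n x ≤ 1 := fun n x => max_le zero_le_one (min_le_left _ _)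
  have hone : ∀ n x, x ≤ t (n + 1) → g n x = 1 := fun n x hx => by
    have : 1 ≤ (t n - x) / (t n - t (n + 1)) := (one_le_div (hpos n)).2 (by linarith)
    simp only [g, min_eq_left this, max_eq_right zero_le_one]
  have hzero : ∀ n x, t n ≤ x → g n x = 0 := fun n x hx =>
    max_eq_left ((min_le_right _ _).trans
      (div_nonpos_of_nonpos_of_nonneg (by linarith) (hpos n).le))
  have hmul : ∀ m n, m < n → ∀ x, g m x * g n x = g n x := fun m n hmn x => by
    rcases le_total (t n) x with hx | hx
    · rw [hzero n x hx, mul_zero]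
    · rw [hone m x (hx.trans (ht.antitone hmn)), one_mul]
  obtain ⟨n, hn⟩ := h.exists_sub_mem_contIdeal (G := fun n => cfc (g n) a)
    (fun m n hmn => by
      constructor
      · rw [← cfc_mul _ _ a (hcont m).continuousOn (hcont n).continuousOn]
        exact cfc_congr fun x _ => hmul m n hmn x
      · rw [← cfc_mul _ _ a (hcont n).continuousOn (hcont m).continuousOn]
        exact cfc_congr fun x _ => (mul_comm _ _).trans (hmul m n hmn x))
    (fun n => norm_cfc_le zero_le_one fun x _ => by
      rw [Real.norm_of_nonneg (hg0 n x)]; exact hg1 n x)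
    (fun n => by
      rw [← cfc_one ℝ a, ← cfc_sub 1 _ a continuousOn_const (hcont n).continuousOn]
      refine norm_cfc_le zero_le_one fun x _ => ?_
      rw [Pi.one_apply, Real.norm_of_nonneg (sub_nonneg.2 (hg1 n x))]
      linarith [hg0 n x])
  have hcontsub : ContinuousOn (fun x => g n x - g (n + 1) x) Set.univ :=
    ((hcont n).sub (hcont (n + 1))).continuousOn
  rw [← hker, ← cfc_sub _ _ a (hcont n).continuousOn (hcont (n + 1)).continuousOn,
    StarAlgHomClass.map_cfc π _ a (hcontsub.mono (Set.subset_univ _)) (map_continuous π) ha hq] at hn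
  have hspec : (1 : ℝ) ∈ spectrum ℝ (cfc (fun x => g n x - g (n + 1) x) (π a)) := by
    rw [cfc_map_spectrum (R := ℝ) _ (π a) hq (hcontsub.mono (Set.subset_univ _))]
    exact ⟨t (n + 1), hmem _, by simp only [hone n _ le_rfl, hzero (n + 1) _ le_rfl, sub_zero]⟩
  rw [hn, spectrum.mem_iff, map_one, sub_zero] at hspec
  exact hspec isUnit_one

theorem finite_spectrum (h : AlmostJordan l r F) (hπ : Function.Surjective π)
    (hker : ∀ a, π a = 0 ↔ a ∈ h.contIdeal) {q : Q} (hq : IsSelfAdjoint q) :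
    (spectrum ℝ q).Finite := by
  by_contra hinf
  have f := Set.Infinite.natEmbedding _ hinf
  obtain ⟨g, hg | hg⟩ := exists_increasing_or_nonincreasing_subseq (· < ·) fun n => (f n : ℝ)
  · obtain ⟨n, hn⟩ := h.not_mem_spectrum_of_strictAnti hπ hker hq.neg
      (t := fun n => -(f (g n) : ℝ)) fun m n hmn => neg_lt_neg (hg m n hmn)
    rw [← spectrum.neg_eq, Set.neg_mem_neg] at hn
    exact hn (f (g n)).2
  · obtain ⟨n, hn⟩ := h.not_mem_spectrum_of_strictAnti hπ hker hq
      (t := fun n => (f (g n) : ℝ)) fun m n hmn => lt_of_le_of_ne (not_lt.1 (hg m n hmn))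
        fun heq => hmn.ne' (g.injective (f.injective (Subtype.ext heq)))
    exact hn (f (g n)).2

theorem exists_bound_contIdeal (h : AlmostJordan l r F) :
    ∃ C, ∀ x ∈ h.contIdeal, ‖x‖ ≤ 1 → ‖F x‖ ≤ C := by
  obtain ⟨C, hC⟩ := h.exists_bound_sq
  have := h.isTwoSided_contIdeal
  have hcl := h.isClosed_contIdeal
  have hpart : ∀ x ∈ h.contIdeal, IsSelfAdjoint x → ‖x‖ ≤ 1 → ∀ ε : ℝ, |ε| = 1 →
      ‖F (cfc (fun s => max (ε * s) 0) x)‖ ≤ C := by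
    intro x hx hxs hx1 ε hε
    have hs : ∀ s ∈ spectrum ℝ x, |s| ≤ 1 := fun s hs => by
      have := norm_apply_le_norm_cfc (fun s : ℝ => s) x hs
      rw [cfc_id' ℝ x, Real.norm_eq_abs] at this
      exact this.trans hx1
    have hb : cfc (fun s => √(max (ε * s) 0)) x * cfc (fun s => √(max (ε * s) 0)) x =
        cfc (fun s => max (ε * s) 0) x := by
      rw [← cfc_mul _ _ x (by fun_prop) (by fun_prop)]
      exact cfc_congr fun s _ => Real.mul_self_sqrt (le_max_right _ _)
    have hf : cfc (fun s => max (ε * s) 0) x * cfc (fun s => max (ε * s) 0) x =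
        cfc (fun s => max (ε * s) 0 * ε) x * x := by
      nth_rw 4 [← cfc_id' ℝ x]
      rw [← cfc_mul _ _ x (by fun_prop) (by fun_prop), ← cfc_mul _ _ x (by fun_prop) (by fun_prop)]
      refine cfc_congr fun s _ => ?_
      rcases le_total (ε * s) 0 with h0 | h0
      · simp [max_eq_right h0]
      · simp only [max_eq_left h0, mul_assoc]
    have hmem : cfc (fun s => √(max (ε * s) 0)) x ∈ h.contIdeal := by
      refine h.contIdeal.mem_of_star_mul_self_mem hcl ?_
      rw [(cfc_predicate (R := ℝ) (fun s => √(max (ε * s) 0)) x : IsSelfAdjoint _).star_eq, hb]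
      refine h.contIdeal.mem_of_star_mul_self_mem hcl ?_
      rw [(cfc_predicate (R := ℝ) (fun s => max (ε * s) 0) x : IsSelfAdjoint _).star_eq, hf]
      exact h.contIdeal.mul_mem_left _ hx
    rw [← hb]
    refine hC _ hmem (norm_cfc_le zero_le_one fun s hs' => ?_)
    rw [Real.norm_of_nonneg (Real.sqrt_nonneg _), Real.sqrt_le_iff, one_pow]
    refine ⟨zero_le_one, max_le ((le_abs_self _).trans ?_) zero_le_one⟩
    rw [abs_mul, hε, one_mul]
    exact hs s hs'
  have hsa : ∀ x ∈ h.contIdeal, IsSelfAdjoint x → ‖x‖ ≤ 1 → ‖F x‖ ≤ C + C := by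
    intro x hx hxs hx1
    have hdec : x = cfc (fun s : ℝ => max (1 * s) 0) x - cfc (fun s : ℝ => max (-1 * s) 0) x := by
      rw [← cfc_sub _ _ x (by fun_prop) (by fun_prop)]
      nth_rw 1 [← cfc_id' ℝ x]
      refine cfc_congr fun s _ => ?_
      rcases le_total s 0 with h0 | h0 <;> simp [h0]
    rw [hdec, map_sub]
    exact (norm_sub_le _ _).trans (add_le_add (hpart x hx hxs hx1 1 (by simp))
      (hpart x hx hxs hx1 (-1) (by simp)))
  refine ⟨(C + C) + (C + C), fun x hx hx1 => ?_⟩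
  have hxs := h.contIdeal.star_mem_of_mem hcl hx
  have hre : (realPart x : A) ∈ h.contIdeal := by
    rw [realPart_apply_coe]
    exact (h.contIdeal.restrictScalars ℝ).smul_mem _ (h.contIdeal.add_mem hx hxs)
  have him : (imaginaryPart x : A) ∈ h.contIdeal := by
    rw [imaginaryPart_apply_coe]
    exact (h.contIdeal.restrictScalars ℂ).smul_mem _
      ((h.contIdeal.restrictScalars ℝ).smul_mem _ (h.contIdeal.sub_mem hx hxs))
  rw [← realPart_add_I_smul_imaginaryPart x, map_add, map_smul]
  refine (norm_add_le _ _).trans (add_le_add ?_ ?_)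
  · exact hsa _ hre (realPart x).2 ((realPart.norm_le x).trans hx1)
  · rw [norm_smul, Complex.norm_I, one_mul]
    exact hsa _ him (imaginaryPart x).2 ((imaginaryPart.norm_le x).trans hx1)

theorem continuous (h : AlmostJordan l r F) : Continuous F := by
  have := h.isTwoSided_contIdeal
  obtain ⟨Q, _, π, hπ, hker⟩ := h.contIdeal.exists_cstarAlgebra_quotient h.isClosed_contIdeal
  have : FiniteDimensional ℂ Q :=
    finiteDimensional_of_finite_spectrum fun q hq => h.finite_spectrum hπ hker hq
  obtain ⟨S, hS⟩ := (π.toAlgHom.toLinearMap).exists_rightInverse_of_surjective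
    (LinearMap.range_eq_top.2 hπ)
  let J : Submodule ℂ A := LinearMap.ker π.toAlgHom.toLinearMap
  obtain ⟨C, hC⟩ := h.exists_bound_contIdeal
  have hFJ : Continuous (F.comp J.subtype) := by
    obtain ⟨K, hK⟩ := LinearMap.bound_of_ball_bound one_pos C (F.comp J.subtype)
      fun x hx => hC _ ((hker _).1 x.2) (mem_ball_zero_iff.1 hx).le
    exact AddMonoidHomClass.continuous_of_bound _ K hK
  have hSπ : Continuous fun x => S (π x) :=
    S.continuous_of_finiteDimensional.comp (map_continuous π)
  have hmem : ∀ x, x - S (π x) ∈ J := fun x => by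
    have : π (S (π x)) = π x := LinearMap.congr_fun hS (π x)
    change π (x - S (π x)) = 0
    rw [map_sub, this, sub_self]
  have h1 : Continuous fun x => F (x - S (π x)) :=
    hFJ.comp ((continuous_id.sub hSπ).subtype_mk hmem)
  have h2 : Continuous fun x => F (S (π x)) :=
    (F.comp S).continuous_of_finiteDimensional.comp (map_continuous π)
  refine (h1.add h2).congr fun x => ?_
  change F (x - S (π x)) + F (S (π x)) = F x
  rw [← map_add, sub_add_cancel]

end AlmostJordan

/-- Theorem 3.1: every generalized Jordan derivation of the third type from a
C*-algebra into a Banach bimodule is continuous. Here `a ∘ b = (ab + ba)/2` and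
`a ∘ m = (a • m + m • a)/2`. -/
theorem stmt_14 {A M : Type*} [NormedRing A] [StarRing A] [CStarRing A]
    [NormedAlgebra ℂ A] [CompleteSpace A] [StarModule ℂ A]
    [NormedAddCommGroup M] [NormedSpace ℂ M] [CompleteSpace M]
    [Module A M] [Module Aᵐᵒᵖ M] [SMulCommClass A Aᵐᵒᵖ M]
    [IsScalarTower ℂ A M] [IsScalarTower ℂ Aᵐᵒᵖ M]
    (hbl : ∀ (a : A) (m : M), ‖a • m‖ ≤ ‖a‖ * ‖m‖)
    (hbr : ∀ (a : A) (m : M), ‖MulOpposite.op a • m‖ ≤ ‖a‖ * ‖m‖)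
    (F : A →ₗ[ℂ] M) (G H : A → M)
    (hFGH : ∀ a b : A,
      F ((2 : ℂ)⁻¹ • (a * b + b * a)) =
        (2 : ℂ)⁻¹ • (MulOpposite.op b • G a + b • G a) +
        (2 : ℂ)⁻¹ • (a • H b + MulOpposite.op a • H b)) :
    Continuous F := by
  let _ : CStarAlgebra A := { }
  let l : A →L[ℂ] M →L[ℂ] M := LinearMap.mkContinuous₂
    (LinearMap.mk₂ ℂ (fun (a : A) (m : M) => a • m) add_smul smul_assoc smul_add
      fun c a m => smul_algebra_smul_comm c a m) 1 fun a m => by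
        rw [one_mul]; exact hbl a m
  let r : A →L[ℂ] M →L[ℂ] M := LinearMap.mkContinuous₂
    (LinearMap.mk₂ ℂ (fun (a : A) (m : M) => MulOpposite.op a • m)
      (fun a b m => by rw [MulOpposite.op_add, add_smul])
      (fun c a m => by rw [MulOpposite.op_smul, smul_assoc])
      (fun a => smul_add _)
      fun c a m => smul_algebra_smul_comm c (MulOpposite.op a) m) 1 fun a m => by
        rw [one_mul]; exact hbr a m
  have hl : ∀ a m, l a m = a • m := fun _ _ => rfl
  have hr : ∀ a m, r a m = MulOpposite.op a • m := fun _ _ => rfl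
  simp only [← hl, ← hr] at hFGH
  have hl1 : ∀ m, l 1 m = m := fun m => by rw [hl, one_smul]
  have hr1 : ∀ m, r 1 m = m := fun m => by rw [hr, MulOpposite.op_one, one_smul]
  have half : ∀ m : M, (2 : ℂ)⁻¹ • (m + m) = m := fun m => by
    rw [← two_smul ℂ, inv_smul_smul₀ two_ne_zero]
  have hH : ∀ b, H b = F b - (2 : ℂ)⁻¹ • (r b (G 1) + l b (G 1)) := fun b => by
    have := hFGH 1 b
    rw [one_mul, mul_one, hl1, hr1, half, ← two_smul ℂ, inv_smul_smul₀ two_ne_zero] at this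
    rw [this, add_sub_cancel_left]
  refine AlmostJordan.continuous (l := l) (r := r) ⟨hl1, hr1, ?_, ?_, ?_, ?_⟩
  · intro a b m
    rw [hl, hl, hl, mul_smul]
  · intro a b m
    rw [hr, hr, hr, MulOpposite.op_mul, mul_smul]
  · intro a b m
    rw [hr, hl, hr, hl, smul_comm a]
  · intro a
    have hcont : Continuous fun x => (r x (G a) + l x (G a)) -
        (l a ((2 : ℂ)⁻¹ • (r x (G 1) + l x (G 1))) +
          r a ((2 : ℂ)⁻¹ • (r x (G 1) + l x (G 1)))) := by fun_prop
    refine hcont.congr fun x => ?_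
    have hF : F (a * x + x * a) = (r x (G a) + l x (G a)) + (l a (H x) + r a (H x)) := by
      have := hFGH a x
      rwa [map_smul, ← smul_add, smul_right_inj (inv_ne_zero two_ne_zero)] at this
    rw [hF, hH, map_sub, map_sub]
    abel
end
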